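/- (Scaled weak Harnack inequality) There exist positive constants ε₃ and C depending only on λ, Λ, K, C₀ and d, such that: for any 0 < r ≤ 1, any 0 < l ≤ 9√d, any f ∈ L^d(Q_l) ∩ C(Q_l), and any nonnegative bounded lower semicontinuous function u that is a viscosity supersolution of −P⁻(D²u) − P⁻_{K,r}(u) + C₀ r |Du| ≥ f in the cube Q_l, one has ‖u‖^{ε₃}_{L^{ε₃}(Q_{l/(9√d)})} ≤ C l^d (inf_{Q_{l/(9√d)}} u + l ‖f‖_{L^d(Q_l)})^{ε₃}. -/

import Mathlib

open MeasureTheory Metric Set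
open scoped RealInnerProductSpace ENNReal

noncomputable section

/-- `d`-dimensional Euclidean space. -/
abbrev Ed (d : ℕ) : Type := EuclideanSpace ℝ (Fin d)

/-- A real-valued function on `ℝ^d` is bounded. -/
def IsBddFun {d : ℕ} (φ : Ed d → ℝ) : Prop := ∃ M, ∀ x, |φ x| ≤ M

/-- The open cube of half side length `δ` centered at `x`. -/
def cubeAt {d : ℕ} (x : Ed d) (δ : ℝ) : Set (Ed d) := {y | ∀ i, |y i - x i| < δ}

/-- The open cube `Q_δ = (-δ, δ)^d`. -/
def cube (d : ℕ) (δ : ℝ) : Set (Ed d) := cubeAt 0 δ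

/-- Hessian matrix of `φ` at `x` (matrix of second derivatives). -/
def hess {d : ℕ} (φ : Ed d → ℝ) (x : Ed d) : Matrix (Fin d) (Fin d) ℝ :=
  Matrix.of fun i j =>
    iteratedFDeriv ℝ 2 φ x ![EuclideanSpace.single i (1 : ℝ), EuclideanSpace.single j (1 : ℝ)]

/-- Symmetric matrices `A` with `λ I ≤ A ≤ Λ I`. -/
def ellipticSet (lam Lam : ℝ) (d : ℕ) : Set (Matrix (Fin d) (Fin d) ℝ) :=
  {A | A.IsSymm ∧ (A - lam • (1 : Matrix (Fin d) (Fin d) ℝ)).PosSemidef ∧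
      (Lam • (1 : Matrix (Fin d) (Fin d) ℝ) - A).PosSemidef}

/-- The Pucci maximal operator `P⁺`. -/
def pucciPlus {d : ℕ} (lam Lam : ℝ) (X : Matrix (Fin d) (Fin d) ℝ) : ℝ :=
  sSup ((fun A => (A * X).trace) '' ellipticSet lam Lam d)

/-- The Pucci minimal operator `P⁻`. -/
def pucciMinus {d : ℕ} (lam Lam : ℝ) (X : Matrix (Fin d) (Fin d) ℝ) : ℝ :=
  sInf ((fun A => (A * X).trace) '' ellipticSet lam Lam d)

/-- The Lévy kernel condition: `K ≥ 0` measurable with `∫ min(|z|²,1) K(z) dz < ∞`. -/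
def KernCond {d : ℕ} (K : Ed d → ℝ) : Prop :=
  Measurable K ∧ (∀ z, 0 ≤ K z) ∧ Integrable (fun z : Ed d => min (‖z‖ ^ 2) 1 * K z)

/-- The rescaled kernel `K_r(z) = r^{d+2} K(rz)`. -/
def Kresc {d : ℕ} (K : Ed d → ℝ) (r : ℝ) (z : Ed d) : ℝ := r ^ (d + 2) * K (r • z)

/-- The second-order increment `u(x+z) − u(x) − 1_{B_{1/r}}(z) Du(x)·z`. -/
def deltaOp {d : ℕ} (φ : Ed d → ℝ) (r : ℝ) (x z : Ed d) : ℝ :=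
  φ (x + z) - φ x - (Metric.ball (0 : Ed d) (1 / r)).indicator (fun w => ⟪gradient φ x, w⟫) z

/-- The maximal nonlocal Pucci operator `P⁺_{K,r}`. -/
def nlPlus {d : ℕ} (K : Ed d → ℝ) (r : ℝ) (φ : Ed d → ℝ) (x : Ed d) : ℝ :=
  ∫ z, max (deltaOp φ r x z) 0 * Kresc K r z

/-- The minimal nonlocal Pucci operator `P⁻_{K,r}`. -/
def nlMinus {d : ℕ} (K : Ed d → ℝ) (r : ℝ) (φ : Ed d → ℝ) (x : Ed d) : ℝ :=
  -∫ z, max (-deltaOp φ r x z) 0 * Kresc K r z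

/-- Viscosity supersolution of `−P⁻(D²u) − P⁻_{K,r}(u) + C₀ r |Du| ≥ f` in `O`. -/
def SupersolExtremal {d : ℕ} (lam Lam C0 r : ℝ) (K f : Ed d → ℝ) (O : Set (Ed d))
    (u : Ed d → ℝ) : Prop :=
  ∀ φ : Ed d → ℝ, ContDiff ℝ 2 φ → IsBddFun φ → ∀ x ∈ O, (∀ y, φ y ≤ u y) → u x = φ x →
    f x ≤ -pucciMinus lam Lam (hess φ x) - nlMinus K r φ x + C0 * r * ‖gradient φ x‖

/-- Viscosity subsolution of `P⁺(D²u) + P⁺_K(u) + C₀|Du| ≥ g` in `O`. -/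
def SubsolPlus {d : ℕ} (lam Lam C0 : ℝ) (K g : Ed d → ℝ) (O : Set (Ed d)) (u : Ed d → ℝ) : Prop :=
  ∀ φ : Ed d → ℝ, ContDiff ℝ 2 φ → IsBddFun φ → ∀ x ∈ O, (∀ y, u y ≤ φ y) → u x = φ x →
    g x ≤ pucciPlus lam Lam (hess φ x) + nlPlus K 1 φ x + C0 * ‖gradient φ x‖

/-- Viscosity supersolution of `P⁻(D²u) + P⁻_K(u) − C₀|Du| ≤ g` in `O`. -/
def SupersolMinus {d : ℕ} (lam Lam C0 : ℝ) (K g : Ed d → ℝ) (O : Set (Ed d)) (u : Ed d → ℝ) : Prop :=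
  ∀ φ : Ed d → ℝ, ContDiff ℝ 2 φ → IsBddFun φ → ∀ x ∈ O, (∀ y, φ y ≤ u y) → u x = φ x →
    pucciMinus lam Lam (hess φ x) + nlMinus K 1 φ x - C0 * ‖gradient φ x‖ ≤ g x

/-- Negative part `f⁻ = −min{f,0}`. -/
def nPart {d : ℕ} (f : Ed d → ℝ) : Ed d → ℝ := fun x => max (-f x) 0

/-- Positive part `f⁺ = max{f,0}`. -/
def pPart {d : ℕ} (f : Ed d → ℝ) : Ed d → ℝ := fun x => max (f x) 0

/-- The `L^p` norm of `f` on a set `S`. -/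
def LnormOn {d : ℕ} (p : ℝ) (S : Set (Ed d)) (f : Ed d → ℝ) : ℝ :=
  (∫ x in S, |f x| ^ p) ^ (1 / p)

/-- The nonlocal contact set `Γ^{n,−}_O(v)`. -/
def nContact {d : ℕ} (O : Set (Ed d)) (v : Ed d → ℝ) : Set (Ed d) :=
  {x | x ∈ O ∧ v x < sInf (v '' Oᶜ) ∧
      ∃ p : Ed d, ∀ y, Metric.infDist y O < Metric.diam O → v x + ⟪p, y - x⟫ ≤ v y}

/-- The set `G^u_M` of points where `u` is touched from below by a paraboloid of opening `M`. -/
def GSet {d : ℕ} (u : Ed d → ℝ) (M : ℝ) : Set (Ed d) :=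
  {x | ∃ ρ > 0, ∃ A C : ℝ, ∃ B : Ed d, |A| + ‖B‖ + |C| ≤ M ∧ u x = A ∧
      ∀ y ∈ Metric.ball x ρ, A + ⟪B, y - x⟫ - C / 2 * ‖y - x‖ ^ 2 ≤ u y}

/-- The bad set `B^u_M`. -/
def BSet {d : ℕ} (u : Ed d → ℝ) (M : ℝ) : Set (Ed d) := (GSet u M)ᶜ

/-- Upper semicontinuous envelope `u*`. -/
def usEnv {d : ℕ} (u : Ed d → ℝ) (x : Ed d) : ℝ :=
  ⨅ ρ : {ρ : ℝ // 0 < ρ}, ⨆ y : {y : Ed d // ‖y - x‖ ≤ ρ.1}, u y.1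

/-- Lower semicontinuous envelope `u_*`. -/
def lsEnv {d : ℕ} (u : Ed d → ℝ) (x : Ed d) : ℝ :=
  ⨆ ρ : {ρ : ℝ // 0 < ρ}, ⨅ y : {y : Ed d // ‖y - x‖ ≤ ρ.1}, u y.1

/-- A modulus of continuity. -/
def IsModulus (m : ℝ → ℝ) : Prop :=
  (∀ t, 0 ≤ m t) ∧ Monotone m ∧ m 0 = 0 ∧ ContinuousAt m 0

/-- The uniform exterior ball condition. -/
def ExtBallCond {d : ℕ} (Ω : Set (Ed d)) : Prop :=
  ∃ ρ > 0, ∀ ξ ∈ frontier Ω, ∃ y ∈ Ωᶜ, Metric.ball y ρ ⊆ Ωᶜ ∧ ξ ∈ Metric.sphere y ρ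

section HJBI

variable {d : ℕ} {𝒜 ℬ : Type}

/-- The linear nonlocal operator `I_{ab}[x, φ]`. -/
def Iop (N : 𝒜 → ℬ → Ed d → Ed d → ℝ) (a : 𝒜) (b : ℬ) (φ : Ed d → ℝ) (x : Ed d) : ℝ :=
  ∫ z, (φ (x + z) - φ x -
      (Metric.ball (0 : Ed d) 1).indicator (fun w => ⟪gradient φ x, w⟫) z) * N a b x z

/-- The HJBI operator evaluated at `φ`, with the zeroth order slot evaluated at `s`. -/
def HJBIat (aM : 𝒜 → ℬ → Ed d → Matrix (Fin d) (Fin d) ℝ) (bV : 𝒜 → ℬ → Ed d → Ed d)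
    (cF fF : 𝒜 → ℬ → Ed d → ℝ) (N : 𝒜 → ℬ → Ed d → Ed d → ℝ)
    (φ : Ed d → ℝ) (s : ℝ) (x : Ed d) : ℝ :=
  ⨆ a, ⨅ b, (-(aM a b x * hess φ x).trace - Iop N a b φ x +
    ⟪bV a b x, gradient φ x⟫ + cF a b x * s + fF a b x)

/-- The HJBI operator `ℐφ(x)`. -/
def HJBIop (aM : 𝒜 → ℬ → Ed d → Matrix (Fin d) (Fin d) ℝ) (bV : 𝒜 → ℬ → Ed d → Ed d)
    (cF fF : 𝒜 → ℬ → Ed d → ℝ) (N : 𝒜 → ℬ → Ed d → Ed d → ℝ)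
    (φ : Ed d → ℝ) (x : Ed d) : ℝ :=
  HJBIat aM bV cF fF N φ (φ x) x

/-- Viscosity subsolution of `ℐu = 0` in `Ω` (test function formulation). -/
def SubsolHJBI (aM : 𝒜 → ℬ → Ed d → Matrix (Fin d) (Fin d) ℝ) (bV : 𝒜 → ℬ → Ed d → Ed d)
    (cF fF : 𝒜 → ℬ → Ed d → ℝ) (N : 𝒜 → ℬ → Ed d → Ed d → ℝ) (Ω : Set (Ed d))
    (u : Ed d → ℝ) : Prop :=
  ∀ φ : Ed d → ℝ, ContDiff ℝ 2 φ → IsBddFun φ → ∀ x ∈ Ω, (∀ y, u y ≤ φ y) → u x = φ x →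
    HJBIop aM bV cF fF N φ x ≤ 0

/-- Viscosity supersolution of `ℐu = 0` in `Ω` (test function formulation). -/
def SupersolHJBI (aM : 𝒜 → ℬ → Ed d → Matrix (Fin d) (Fin d) ℝ) (bV : 𝒜 → ℬ → Ed d → Ed d)
    (cF fF : 𝒜 → ℬ → Ed d → ℝ) (N : 𝒜 → ℬ → Ed d → Ed d → ℝ) (Ω : Set (Ed d))
    (u : Ed d → ℝ) : Prop :=
  ∀ φ : Ed d → ℝ, ContDiff ℝ 2 φ → IsBddFun φ → ∀ x ∈ Ω, (∀ y, φ y ≤ u y) → u x = φ x →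
    0 ≤ HJBIop aM bV cF fF N φ x

/-- Uniform ellipticity of the HJBI operator `ℐ`. -/
def UnifElliptic (lam Lam C0 : ℝ) (K : Ed d → ℝ) (Ω : Set (Ed d))
    (aM : 𝒜 → ℬ → Ed d → Matrix (Fin d) (Fin d) ℝ) (bV : 𝒜 → ℬ → Ed d → Ed d)
    (cF fF : 𝒜 → ℬ → Ed d → ℝ) (N : 𝒜 → ℬ → Ed d → Ed d → ℝ) : Prop :=
  ∃ m : ℝ → ℝ, IsModulus m ∧
    ∀ r s : ℝ, ∀ x ∈ Ω, ∀ φ ψ : Ed d → ℝ,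
      ContDiff ℝ 2 φ → IsBddFun φ → ContDiff ℝ 2 ψ → IsBddFun ψ →
      (pucciMinus lam Lam (hess (fun y => φ y - ψ y) x) + nlMinus K 1 (fun y => φ y - ψ y) x -
          C0 * ‖gradient (fun y => ψ y - φ y) x‖ - m |r - s| ≤
        HJBIat aM bV cF fF N ψ r x - HJBIat aM bV cF fF N φ s x) ∧
      (HJBIat aM bV cF fF N ψ r x - HJBIat aM bV cF fF N φ s x ≤
        pucciPlus lam Lam (hess (fun y => φ y - ψ y) x) + nlPlus K 1 (fun y => φ y - ψ y) x +
          C0 * ‖gradient (fun y => ψ y - φ y) x‖ + m |r - s|)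

/-- Boundedness of the coefficient families, uniformly in `a, b`. -/
def FamiliesBdd (Ω : Set (Ed d)) (aM : 𝒜 → ℬ → Ed d → Matrix (Fin d) (Fin d) ℝ)
    (bV : 𝒜 → ℬ → Ed d → Ed d) (cF fF : 𝒜 → ℬ → Ed d → ℝ) : Prop :=
  ∃ Cb : ℝ, ∀ a b, ∀ x ∈ Ω, (∀ i j, |aM a b x i j| ≤ Cb) ∧ ‖bV a b x‖ ≤ Cb ∧
      |cF a b x| ≤ Cb ∧ |fF a b x| ≤ Cb

/-- Uniform continuity of the coefficient families with a common modulus, uniformly in `a, b, z`. -/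
def FamiliesUC (Ω : Set (Ed d)) (aM : 𝒜 → ℬ → Ed d → Matrix (Fin d) (Fin d) ℝ)
    (bV : 𝒜 → ℬ → Ed d → Ed d) (cF fF : 𝒜 → ℬ → Ed d → ℝ)
    (N : 𝒜 → ℬ → Ed d → Ed d → ℝ) : Prop :=
  ∃ m₀ : ℝ → ℝ, IsModulus m₀ ∧ ∀ a b, ∀ x ∈ Ω, ∀ y ∈ Ω,
      (∀ i j, |aM a b x i j - aM a b y i j| ≤ m₀ ‖x - y‖) ∧
      ‖bV a b x - bV a b y‖ ≤ m₀ ‖x - y‖ ∧ |cF a b x - cF a b y| ≤ m₀ ‖x - y‖ ∧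
      |fF a b x - fF a b y| ≤ m₀ ‖x - y‖ ∧ ∀ z, |N a b x z - N a b y z| ≤ m₀ ‖x - y‖

end HJBI

section HarnackProof

set_option maxSynthPendingDepth 3
/-! ### Test functions with quantitative `C²` bounds -/

/-- `φ` is `C²` with oscillation, gradient and Hessian bounded by `N`. -/
structure C2B {d : ℕ} (φ : Ed d → ℝ) (N : ℝ) : Prop where
  cd : ContDiff ℝ 2 φ
  osc : ∀ x y, |φ x - φ y| ≤ N
  d1 : ∀ x, ‖fderiv ℝ φ x‖ ≤ N
  d2 : ∀ x, ‖fderiv ℝ (fderiv ℝ φ) x‖ ≤ N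

lemma C2B.nonneg {d : ℕ} {φ : Ed d → ℝ} {N : ℝ} (h : C2B φ N) : 0 ≤ N :=
  (abs_nonneg _).trans (h.osc 0 0)

lemma C2B.mono {d : ℕ} {φ : Ed d → ℝ} {N N' : ℝ} (h : C2B φ N) (hN : N ≤ N') : C2B φ N' :=
  ⟨h.cd, fun x y => (h.osc x y).trans hN, fun x => (h.d1 x).trans hN,
    fun x => (h.d2 x).trans hN⟩

lemma C2B.bdd {d : ℕ} {φ : Ed d → ℝ} {N : ℝ} (h : C2B φ N) : IsBddFun φ :=
  ⟨|φ 0| + N, fun x => by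
    have h1 := h.osc x 0
    have h2 := abs_sub_abs_le_abs_sub (φ x) (φ 0)
    linarith⟩

lemma cd_diff {d : ℕ} {φ : Ed d → ℝ} (h : ContDiff ℝ 2 φ) : Differentiable ℝ φ :=
  h.differentiable (by norm_num)

lemma cd_diff2 {d : ℕ} {φ : Ed d → ℝ} (h : ContDiff ℝ 2 φ) : Differentiable ℝ (fderiv ℝ φ) :=
  (h.fderiv_right (m := 1) (by norm_num)).differentiable (by norm_num)

lemma fderiv2_add {d : ℕ} {φ ψ : Ed d → ℝ} (h : ContDiff ℝ 2 φ) (h' : ContDiff ℝ 2 ψ) (x : Ed d) :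
    fderiv ℝ (fderiv ℝ (fun y => φ y + ψ y)) x
      = fderiv ℝ (fderiv ℝ φ) x + fderiv ℝ (fderiv ℝ ψ) x := by
  have : fderiv ℝ (fun y => φ y + ψ y) = fun y => fderiv ℝ φ y + fderiv ℝ ψ y := by
    funext y
    exact fderiv_fun_add (cd_diff h y) (cd_diff h' y)
  rw [this]
  exact fderiv_fun_add (cd_diff2 h x) (cd_diff2 h' x)

lemma fderiv2_mul {d : ℕ} {φ : Ed d → ℝ} (h : ContDiff ℝ 2 φ) (a : ℝ) (x : Ed d) :
    fderiv ℝ (fderiv ℝ (fun y => a * φ y)) x = a • fderiv ℝ (fderiv ℝ φ) x := by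
  have : fderiv ℝ (fun y => a * φ y) = fun y => a • fderiv ℝ φ y := by
    funext y
    exact fderiv_const_mul (cd_diff h y) a
  rw [this]
  exact fderiv_fun_const_smul (cd_diff2 h x) a

lemma C2B.add {d : ℕ} {φ ψ : Ed d → ℝ} {N N' : ℝ} (h : C2B φ N) (h' : C2B ψ N') :
    C2B (fun y => φ y + ψ y) (N + N') := by
  refine ⟨h.cd.add h'.cd, fun x y => ?_, fun x => ?_, fun x => ?_⟩
  · have : φ x + ψ x - (φ y + ψ y) = (φ x - φ y) + (ψ x - ψ y) := by ring
    rw [this]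
    exact (abs_add_le _ _).trans (add_le_add (h.osc x y) (h'.osc x y))
  · rw [fderiv_fun_add (cd_diff h.cd x) (cd_diff h'.cd x)]
    exact (norm_add_le _ _).trans (add_le_add (h.d1 x) (h'.d1 x))
  · rw [fderiv2_add h.cd h'.cd]
    exact (norm_add_le _ _).trans (add_le_add (h.d2 x) (h'.d2 x))

lemma C2B.mul {d : ℕ} {φ : Ed d → ℝ} {N : ℝ} (h : C2B φ N) (a : ℝ) :
    C2B (fun y => a * φ y) (|a| * N) := by
  refine ⟨contDiff_const.mul h.cd, fun x y => ?_, fun x => ?_, fun x => ?_⟩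
  · rw [← mul_sub, abs_mul]
    exact mul_le_mul_of_nonneg_left (h.osc x y) (abs_nonneg _)
  · rw [fderiv_const_mul (cd_diff h.cd x) a, norm_smul]
    exact mul_le_mul_of_nonneg_left (h.d1 x) (abs_nonneg _)
  · rw [fderiv2_mul h.cd, norm_smul]
    exact mul_le_mul_of_nonneg_left (h.d2 x) (abs_nonneg _)

lemma C2B.const {d : ℕ} (c : ℝ) : C2B (fun _ : Ed d => c) 0 := by
  refine ⟨contDiff_const, fun x y => by simp, fun x => by simp, fun x => ?_⟩
  have : fderiv ℝ (fun _ : Ed d => c) = fun _ => 0 := by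
    funext y; simp
  rw [this]; simp

lemma C2B.addConst {d : ℕ} {φ : Ed d → ℝ} {N : ℝ} (h : C2B φ N) (c : ℝ) :
    C2B (fun y => φ y + c) N := by
  have := h.add (C2B.const c)
  simpa using this

lemma hasFDerivAt_scale {d : ℕ} (x0 : Ed d) (s : ℝ) (x : Ed d) :
    HasFDerivAt (fun y : Ed d => s⁻¹ • (y - x0)) (s⁻¹ • ContinuousLinearMap.id ℝ (Ed d)) x := by
  exact ((hasFDerivAt_id x).sub_const x0).const_smul s⁻¹

lemma fderiv_scale {d : ℕ} {φ : Ed d → ℝ} (h : ContDiff ℝ 2 φ) (x0 : Ed d) (s : ℝ) :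
    fderiv ℝ (fun y => φ (s⁻¹ • (y - x0))) = fun x => s⁻¹ • fderiv ℝ φ (s⁻¹ • (x - x0)) := by
  funext x
  have h1 := (cd_diff h (s⁻¹ • (x - x0))).hasFDerivAt.comp x (hasFDerivAt_scale x0 s x)
  have h2 := h1.fderiv
  rw [show (φ ∘ fun y : Ed d => s⁻¹ • (y - x0)) = fun y => φ (s⁻¹ • (y - x0)) from rfl] at h2
  rw [h2]
  ext v
  simp

lemma fderiv2_scale {d : ℕ} {φ : Ed d → ℝ} (h : ContDiff ℝ 2 φ) (x0 : Ed d) (s : ℝ) (x : Ed d) :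
    fderiv ℝ (fderiv ℝ (fun y => φ (s⁻¹ • (y - x0)))) x
      = (s⁻¹) ^ 2 • fderiv ℝ (fderiv ℝ φ) (s⁻¹ • (x - x0)) := by
  rw [fderiv_scale h]
  have h1 := ((cd_diff2 h (s⁻¹ • (x - x0))).hasFDerivAt.comp x
    (hasFDerivAt_scale x0 s x)).const_smul s⁻¹
  have h2 := h1.fderiv
  rw [show (s⁻¹ • (fderiv ℝ φ ∘ fun y : Ed d => s⁻¹ • (y - x0)))
    = fun x => s⁻¹ • fderiv ℝ φ (s⁻¹ • (x - x0)) from rfl] at h2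
  rw [h2]
  ext v w
  simp [pow_two, mul_assoc]

lemma C2B.scale {d : ℕ} {φ : Ed d → ℝ} {N : ℝ} (h : C2B φ N) (x0 : Ed d) {s : ℝ} (hs : 0 < s)
    (hs1 : s ≤ 1) : C2B (fun y => φ (s⁻¹ • (y - x0))) ((s⁻¹) ^ 2 * N) := by
  have hN := h.nonneg
  have h1 : 1 ≤ s⁻¹ := (one_le_inv₀ hs).2 hs1
  have h0 : 0 < s⁻¹ := inv_pos.2 hs
  refine ⟨?_, fun x y => ?_, fun x => ?_, fun x => ?_⟩
  · exact h.cd.comp (by fun_prop)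
  · refine (h.osc _ _).trans ?_
    nlinarith [one_le_pow₀ h1 (n := 2)]
  · rw [fderiv_scale h.cd, norm_smul, Real.norm_of_nonneg h0.le]
    have := mul_le_mul_of_nonneg_left (h.d1 (s⁻¹ • (x - x0))) h0.le
    refine this.trans (mul_le_mul_of_nonneg_right ?_ hN)
    nlinarith
  · rw [fderiv2_scale h.cd, norm_smul, Real.norm_of_nonneg (by positivity)]
    exact mul_le_mul_of_nonneg_left (h.d2 _) (by positivity)

lemma C2B.taylor {d : ℕ} {φ : Ed d → ℝ} {N : ℝ} (h : C2B φ N) (x z : Ed d) :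
    |φ (x + z) - φ x - fderiv ℝ φ x z| ≤ N * ‖z‖ ^ 2 := by
  have hlip : ∀ y, ‖fderiv ℝ φ y - fderiv ℝ φ x‖ ≤ N * ‖y - x‖ := fun y =>
    Convex.norm_image_sub_le_of_norm_fderiv_le (𝕜 := ℝ) (s := univ)
      (fun w _ => cd_diff2 h.cd w) (fun w _ => h.d2 w) convex_univ (mem_univ x) (mem_univ y)
  have h1 := Convex.norm_image_sub_le_of_norm_hasFDerivWithin_le'  (𝕜 := ℝ) (f := φ)
    (f' := fderiv ℝ φ) (φ := fderiv ℝ φ x) (s := closedBall x ‖z‖) (C := N * ‖z‖)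
    (x := x) (y := x + z)
    (fun w _ => (cd_diff h.cd w).hasFDerivAt.hasFDerivWithinAt)
    (fun w hw => (hlip w).trans (mul_le_mul_of_nonneg_left (by
      simpa [dist_eq_norm] using hw) h.nonneg)) (convex_closedBall _ _)
    (by simp) (by simp [dist_eq_norm])
  simpa [pow_two, mul_assoc] using h1

lemma C2B.of_compact {d : ℕ} {φ : Ed d → ℝ} (h : ContDiff ℝ 2 φ) (hc : HasCompactSupport φ) :
    ∃ N, C2B φ N := by
  obtain ⟨N0, h0⟩ := hc.exists_bound_of_continuous h.continuous
  have hf1 : Continuous (fderiv ℝ φ) := (cd_diff2 h).continuous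
  have hf2 : Continuous (fderiv ℝ (fderiv ℝ φ)) :=
    (h.fderiv_right (m := 1) (by norm_num)).continuous_fderiv (by norm_num)
  obtain ⟨N1, h1⟩ := (hc.fderiv (𝕜 := ℝ)).exists_bound_of_continuous hf1
  obtain ⟨N2, h2⟩ := ((hc.fderiv (𝕜 := ℝ)).fderiv (𝕜 := ℝ)).exists_bound_of_continuous hf2
  have a0 : 0 ≤ N0 := (norm_nonneg _).trans (h0 0)
  have a1 : 0 ≤ N1 := (norm_nonneg _).trans (h1 0)
  have a2 : 0 ≤ N2 := (norm_nonneg _).trans (h2 0)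
  refine ⟨2 * N0 + N1 + N2, h, fun x y => ?_, fun x => (h1 x).trans (by linarith),
    fun x => (h2 x).trans (by linarith)⟩
  have := abs_sub (φ x) (φ y)
  have b1 := h0 x
  have b2 := h0 y
  rw [Real.norm_eq_abs] at b1 b2
  linarith

/-! ### Traces against the Hessian -/

/-- `tr (A D²φ(x))`. -/
def trH {d : ℕ} (A : Matrix (Fin d) (Fin d) ℝ) (φ : Ed d → ℝ) (x : Ed d) : ℝ :=
  (A * hess φ x).trace

lemma trH_eq {d : ℕ} (A : Matrix (Fin d) (Fin d) ℝ) (φ : Ed d → ℝ) (x : Ed d) :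
    trH A φ x = ∑ i, ∑ j, A i j * fderiv ℝ (fderiv ℝ φ) x
      (EuclideanSpace.single j (1 : ℝ)) (EuclideanSpace.single i (1 : ℝ)) := by
  simp [trH, Matrix.trace, Matrix.mul_apply, hess, iteratedFDeriv_two_apply]

lemma trH_add {d : ℕ} (A : Matrix (Fin d) (Fin d) ℝ) {φ ψ : Ed d → ℝ} (h : ContDiff ℝ 2 φ)
    (h' : ContDiff ℝ 2 ψ) (x : Ed d) :
    trH A (fun y => φ y + ψ y) x = trH A φ x + trH A ψ x := by
  simp only [trH_eq, fderiv2_add h h', add_apply, mul_add,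
    Finset.sum_add_distrib]

lemma trH_addConst {d : ℕ} (A : Matrix (Fin d) (Fin d) ℝ) {φ : Ed d → ℝ} (c : ℝ) (x : Ed d) :
    trH A (fun y => φ y + c) x = trH A φ x := by
  have : fderiv ℝ (fun y => φ y + c) = fderiv ℝ φ := by
    funext y; exact fderiv_add_const c
  simp only [trH_eq, this]

lemma trH_mul {d : ℕ} (A : Matrix (Fin d) (Fin d) ℝ) {φ : Ed d → ℝ} (h : ContDiff ℝ 2 φ)
    (a : ℝ) (x : Ed d) :
    trH A (fun y => a * φ y) x = a * trH A φ x := by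
  simp only [trH_eq, fderiv2_mul h, smul_apply, Finset.mul_sum, smul_eq_mul]
  refine Finset.sum_congr rfl fun i _ => Finset.sum_congr rfl fun j _ => by ring

lemma trH_scale {d : ℕ} (A : Matrix (Fin d) (Fin d) ℝ) {φ : Ed d → ℝ} (h : ContDiff ℝ 2 φ)
    (x0 : Ed d) (s : ℝ) (x : Ed d) :
    trH A (fun y => φ (s⁻¹ • (y - x0))) x = (s⁻¹) ^ 2 * trH A φ (s⁻¹ • (x - x0)) := by
  simp only [trH_eq, fderiv2_scale h, smul_apply, Finset.mul_sum, smul_eq_mul]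
  refine Finset.sum_congr rfl fun i _ => Finset.sum_congr rfl fun j _ => by ring

lemma elliptic_quad {d : ℕ} {lam Lam : ℝ} {A : Matrix (Fin d) (Fin d) ℝ}
    (hA : A ∈ ellipticSet lam Lam d) (v : Fin d → ℝ) :
    lam * ∑ i, v i ^ 2 ≤ ∑ i, ∑ j, A i j * (v i * v j) := by
  have h := hA.2.1.dotProduct_mulVec_nonneg v
  have e1 : ∑ i, ∑ j, A i j * (v i * v j) = v ⬝ᵥ (A.mulVec v) := by
    simp only [dotProduct, Matrix.mulVec, Finset.mul_sum]
    refine Finset.sum_congr rfl fun i _ => Finset.sum_congr rfl fun j _ => by ring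
  have e2 : ∑ i, v i ^ 2 = v ⬝ᵥ v := by
    simp only [dotProduct]
    refine Finset.sum_congr rfl fun i _ => by ring
  rw [e1, e2]
  simp only [Matrix.sub_mulVec, dotProduct_sub, Matrix.smul_mulVec, Matrix.one_mulVec,
    dotProduct_smul, star_trivial, smul_eq_mul] at h
  linarith

lemma elliptic_diag {d : ℕ} {lam Lam : ℝ} {A : Matrix (Fin d) (Fin d) ℝ}
    (hA : A ∈ ellipticSet lam Lam d) (i : Fin d) : A i i ≤ Lam := by
  have h := hA.2.2.diag_nonneg (i := i)
  simp at h
  exact h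

lemma elliptic_diag' {d : ℕ} {lam Lam : ℝ} {A : Matrix (Fin d) (Fin d) ℝ}
    (hA : A ∈ ellipticSet lam Lam d) (i : Fin d) : lam ≤ A i i := by
  have h := hA.2.1.diag_nonneg (i := i)
  simp at h
  exact h

lemma elliptic_entry {d : ℕ} {lam Lam : ℝ} (hlam : 0 < lam) {A : Matrix (Fin d) (Fin d) ℝ}
    (hA : A ∈ ellipticSet lam Lam d) (i j : Fin d) : |A i j| ≤ Lam := by
  have hLi := elliptic_diag hA i
  have hLj := elliptic_diag hA j
  by_cases hij : i = j
  · subst hij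
    rw [abs_of_nonneg (hlam.le.trans (elliptic_diag' hA i))]
    exact hLi
  have key : ∀ t : ℝ, 0 ≤ A i i + t * A i j + t * A j i + t ^ 2 * A j j := by
    intro t
    have h := elliptic_quad hA (fun k => (if k = i then 1 else 0) + t * (if k = j then 1 else 0))
    have h0 : 0 ≤ lam * ∑ k, ((if k = i then (1 : ℝ) else 0) + t * (if k = j then 1 else 0)) ^ 2 :=
      mul_nonneg hlam.le (Finset.sum_nonneg fun k _ => sq_nonneg _)
    have h2 := h0.trans h
    have e : ∀ a b : Fin d, A a b * (((if a = i then (1 : ℝ) else 0) + t * (if a = j then 1 else 0))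
        * ((if b = i then (1 : ℝ) else 0) + t * (if b = j then 1 else 0)))
        = (if a = i then (if b = i then A a b else 0) else 0)
          + (if a = i then (if b = j then t * A a b else 0) else 0)
          + (if a = j then (if b = i then t * A a b else 0) else 0)
          + (if a = j then (if b = j then t ^ 2 * A a b else 0) else 0) := by
      intro a b
      split_ifs <;> ring
    simp only [e, Finset.sum_add_distrib] at h2
    simp at h2
    linarith
  have hs : A j i = A i j := by
    have := congrFun (congrFun hA.1 i) j
    simpa [Matrix.transpose_apply] using this
  have k1 := key 1
  have k2 := key (-1)
  rw [hs] at k1 k2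
  rw [abs_le]
  constructor <;> linarith

lemma trH_bound {d : ℕ} {lam Lam : ℝ} (hlam : 0 < lam) {A : Matrix (Fin d) (Fin d) ℝ}
    (hA : A ∈ ellipticSet lam Lam d) {φ : Ed d → ℝ} {N : ℝ} (h : C2B φ N) (x : Ed d) :
    |trH A φ x| ≤ (d : ℝ) ^ 2 * Lam * N := by
  rw [trH_eq]
  refine (Finset.abs_sum_le_sum_abs _ _).trans ?_
  have : ∀ i ∈ (Finset.univ : Finset (Fin d)), |∑ j, A i j * fderiv ℝ (fderiv ℝ φ) x
      (EuclideanSpace.single j (1 : ℝ)) (EuclideanSpace.single i (1 : ℝ))| ≤ d * (Lam * N) := by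
    intro i _
    refine (Finset.abs_sum_le_sum_abs _ _).trans ?_
    have h2 : ∀ j ∈ (Finset.univ : Finset (Fin d)), |A i j * fderiv ℝ (fderiv ℝ φ) x
      (EuclideanSpace.single j (1 : ℝ)) (EuclideanSpace.single i (1 : ℝ))| ≤ Lam * N := by
      intro j _
      rw [abs_mul]
      refine mul_le_mul (elliptic_entry hlam hA i j) ?_ (abs_nonneg _)
        ((abs_nonneg _).trans (elliptic_entry hlam hA i j))
      have := (fderiv ℝ (fderiv ℝ φ) x).le_opNorm₂ (EuclideanSpace.single j (1 : ℝ))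
        (EuclideanSpace.single i (1 : ℝ))
      simp at this
      exact this.trans (h.d2 x)
    refine (Finset.sum_le_sum h2).trans ?_
    simp
  refine (Finset.sum_le_sum this).trans ?_
  simp
  apply le_of_eq; ring

lemma trH_congr {d : ℕ} (A : Matrix (Fin d) (Fin d) ℝ) {φ ψ : Ed d → ℝ} {x : Ed d}
    (h : φ =ᶠ[nhds x] ψ) : trH A φ x = trH A ψ x := by
  simp only [trH_eq, h.fderiv.fderiv_eq]

/-! ### The abstract notion of supersolution used in the proof -/

/-- Quantitative viscosity supersolution: `P⁻(D²u) ≤ -f + κ N` for test functions with `C²`-size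
at most `N`. -/
def Sol {d : ℕ} (lam Lam κ : ℝ) (f : Ed d → ℝ) (O : Set (Ed d)) (u : Ed d → ℝ) : Prop :=
  ∀ (φ : Ed d → ℝ) (N c : ℝ) (x : Ed d), C2B φ N → x ∈ O → (∀ y, φ y ≤ u y) → u x = φ x →
    (∀ A ∈ ellipticSet lam Lam d, c ≤ trH A φ x) → c ≤ -f x + κ * N

lemma Sol.scale {d : ℕ} {lam Lam κ : ℝ} {f : Ed d → ℝ} {O : Set (Ed d)}
    {u : Ed d → ℝ} (h : Sol lam Lam κ f O u) (x0 : Ed d) {s m : ℝ} (hs : 0 < s) (hs1 : s ≤ 1)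
    (hm : 0 < m) :
    Sol lam Lam κ (fun y => s ^ 2 / m * f (x0 + s • y)) {y | x0 + s • y ∈ O}
      (fun y => u (x0 + s • y) / m) := by
  intro φ N c x hφ hx hle heq hc
  have hsc : s⁻¹ • (x0 + s • x - x0) = x := by
    rw [add_sub_cancel_left, smul_smul, inv_mul_cancel₀ hs.ne', one_smul]
  have h1 := h (fun y => m * φ (s⁻¹ • (y - x0))) (|m| * ((s⁻¹) ^ 2 * N)) (m * ((s⁻¹) ^ 2 * c))
    (x0 + s • x) ((hφ.scale x0 hs hs1).mul m) hx ?_ ?_ ?_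
  · rw [abs_of_pos hm] at h1
    have h2 : s ^ 2 / m * (m * ((s⁻¹) ^ 2 * c)) ≤ s ^ 2 / m * (-f (x0 + s • x) + κ * (m * ((s⁻¹) ^ 2 * N))) :=
      mul_le_mul_of_nonneg_left h1 (by positivity)
    have e1 : s ^ 2 / m * (m * ((s⁻¹) ^ 2 * c)) = c := by field_simp
    have e2 : s ^ 2 / m * (-f (x0 + s • x) + κ * (m * ((s⁻¹) ^ 2 * N)))
      = -(s ^ 2 / m * f (x0 + s • x)) + κ * N := by field_simp
    rw [e1, e2] at h2
    exact h2
  · intro y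
    have := hle (s⁻¹ • (y - x0))
    have e : x0 + s • s⁻¹ • (y - x0) = y := by
      rw [smul_smul, mul_inv_cancel₀ hs.ne', one_smul]; abel
    simp only [e] at this
    rw [le_div_iff₀ hm] at this
    linarith
  · simp only [hsc]
    rw [← heq]
    field_simp
  · intro A hA
    rw [trH_mul A (hφ.scale x0 hs hs1).cd, trH_scale A hφ.cd, hsc]
    exact mul_le_mul_of_nonneg_left (mul_le_mul_of_nonneg_left (hc A hA) (by positivity)) hm.le


/-! ### From the integro-differential inequality to `Sol` -/

/-- Rescaled integrable majorant of the second order increments. -/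
def Ht {d : ℕ} (t : ℝ) (w : Ed d) : ℝ :=
  if ‖w‖ < 1 then min (‖w‖ ^ 2) (t ^ 2 + t * ‖w‖) else t ^ 2

lemma Ht_meas {d : ℕ} (t : ℝ) : Measurable (Ht t : Ed d → ℝ) := by
  unfold Ht
  refine Measurable.ite (measurableSet_lt measurable_norm measurable_const) ?_ measurable_const
  exact (measurable_norm.pow_const 2).min (measurable_const.add (measurable_const.mul measurable_norm))

lemma Ht_nonneg {d : ℕ} {t : ℝ} (ht : 0 ≤ t) (w : Ed d) : 0 ≤ Ht t w := by
  unfold Ht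
  split_ifs <;> positivity

lemma Ht_le {d : ℕ} {t : ℝ} (ht : 0 ≤ t) (ht1 : t ≤ 1) (w : Ed d) :
    Ht t w ≤ min (‖w‖ ^ 2) 1 := by
  have h0 := norm_nonneg w
  unfold Ht
  split_ifs with h
  · refine le_min (min_le_left _ _) ((min_le_left _ _).trans ?_)
    nlinarith
  · push Not at h
    refine le_min ?_ ?_ <;> nlinarith

lemma Ht_le' {d : ℕ} {t : ℝ} (ht : 0 ≤ t) (w : Ed d) : Ht t w ≤ t ^ 2 + t * ‖w‖ := by
  have h0 := norm_nonneg w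
  unfold Ht
  split_ifs with h
  · exact min_le_right _ _
  · nlinarith [mul_nonneg ht h0]

lemma Ht_integrable {d : ℕ} {K : Ed d → ℝ} (hK : KernCond K) {t : ℝ} (ht : 0 ≤ t) (ht1 : t ≤ 1) :
    Integrable (fun w => Ht t w * K w) := by
  refine hK.2.2.mono' ((Ht_meas t).mul hK.1).aestronglyMeasurable ?_
  refine Filter.Eventually.of_forall fun w => ?_
  rw [Real.norm_of_nonneg (mul_nonneg (Ht_nonneg ht w) (hK.2.1 w))]
  exact mul_le_mul_of_nonneg_right (Ht_le ht ht1 w) (hK.2.1 w)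

lemma Ht_small {d : ℕ} {K : Ed d → ℝ} (hK : KernCond K) {κ : ℝ} (hκ : 0 < κ) :
    ∃ t0, 0 < t0 ∧ t0 ≤ 1 ∧ ∀ t, 0 < t → t ≤ t0 → ∫ w, Ht t w * K w ≤ κ := by
  have hev : ∀ᶠ t : ℝ in nhdsWithin 0 (Ioi 0), 0 < t ∧ t ≤ 1 := by
    have h1 : ∀ᶠ t : ℝ in nhdsWithin 0 (Ioi 0), t ∈ Ioi (0 : ℝ) := self_mem_nhdsWithin
    have h2 : ∀ᶠ t : ℝ in nhdsWithin 0 (Ioi 0), t < 1 :=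
      nhdsWithin_le_nhds (gt_mem_nhds one_pos)
    filter_upwards [h1, h2] with t a b using ⟨a, b.le⟩
  have hlim : Filter.Tendsto (fun t : ℝ => ∫ w, Ht t w * K w) (nhdsWithin 0 (Ioi 0))
      (nhds (∫ _ : Ed d, (0 : ℝ))) := by
    refine tendsto_integral_filter_of_dominated_convergence
      (fun z : Ed d => min (‖z‖ ^ 2) 1 * K z) ?_ ?_ hK.2.2 ?_
    · exact Filter.Eventually.of_forall fun t => ((Ht_meas t).mul hK.1).aestronglyMeasurable
    · filter_upwards [hev] with t ht
      refine Filter.Eventually.of_forall fun w => ?_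
      rw [Real.norm_of_nonneg (mul_nonneg (Ht_nonneg ht.1.le w) (hK.2.1 w))]
      exact mul_le_mul_of_nonneg_right (Ht_le ht.1.le ht.2 w) (hK.2.1 w)
    · refine Filter.Eventually.of_forall fun w => ?_
      have hc : Filter.Tendsto (fun t : ℝ => (t ^ 2 + t * ‖w‖) * K w) (nhdsWithin 0 (Ioi 0))
          (nhds 0) := by
        have : Continuous (fun t : ℝ => (t ^ 2 + t * ‖w‖) * K w) := by fun_prop
        have h3 := (this.tendsto 0).mono_left (nhdsWithin_le_nhds (s := Ioi (0 : ℝ)))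
        simpa using h3
      refine tendsto_of_tendsto_of_tendsto_of_le_of_le' tendsto_const_nhds hc ?_ ?_
      · filter_upwards [hev] with t ht using mul_nonneg (Ht_nonneg ht.1.le w) (hK.2.1 w)
      · filter_upwards [hev] with t ht using
          mul_le_mul_of_nonneg_right (Ht_le' ht.1.le w) (hK.2.1 w)
  rw [integral_zero] at hlim
  have h4 := hlim.eventually (gt_mem_nhds hκ)
  have h5 := hev.and h4
  rw [eventually_nhdsWithin_iff, Metric.eventually_nhds_iff] at h5
  obtain ⟨ε, hε, h6⟩ := h5
  refine ⟨min (ε / 2) 1, by positivity, min_le_right _ _, fun t ht htle => ?_⟩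
  refine (h6 (y := t) ?_ ht).2.le
  rw [Real.dist_eq, sub_zero, abs_of_pos ht]
  linarith [htle.trans (min_le_left _ _)]

lemma nl_bound {d : ℕ} {K : Ed d → ℝ} (hK : KernCond K) {r s : ℝ} (hr : 0 < r) (hr1 : r ≤ 1)
    (hs : 0 < s) (hs1 : s ≤ 1) {φ : Ed d → ℝ} {N : ℝ} (hφ : C2B φ N) (x0 x : Ed d) :
    s ^ 2 * (-nlMinus K r (fun y => φ (s⁻¹ • (y - x0))) x) ≤ N * ∫ w, Ht (r * s) w * K w := by
  set ψ : Ed d → ℝ := fun y => φ (s⁻¹ • (y - x0)) with hψ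
  have hN := hφ.nonneg
  have ht0 : 0 < r * s := mul_pos hr hs
  have ht1 : r * s ≤ 1 := by nlinarith
  have hψcd : ContDiff ℝ 2 ψ := (hφ.scale x0 hs hs1).cd
  -- pointwise bound
  have hpt : ∀ z, max (-deltaOp ψ r x z) 0 ≤ (s⁻¹) ^ 2 * (r⁻¹) ^ 2 * (N * Ht (r * s) (r • z)) := by
    intro z
    have hinv : (s⁻¹) ^ 2 * (r⁻¹) ^ 2 * (r * s) ^ 2 = 1 := by field_simp
    have hHn : 0 ≤ (s⁻¹) ^ 2 * (r⁻¹) ^ 2 * (N * Ht (r * s) (r • z)) :=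
      mul_nonneg (by positivity) (mul_nonneg hN (Ht_nonneg ht0.le _))
    refine max_le ?_ hHn
    have hosc : |ψ (x + z) - ψ x| ≤ N := hφ.osc _ _
    have hgrad : ⟪gradient ψ x, z⟫ = fderiv ℝ ψ x z := by
      rw [gradient, InnerProductSpace.toDual_symm_apply]
    have hfd : ‖fderiv ℝ ψ x‖ ≤ s⁻¹ * N := by
      rw [hψ, fderiv_scale hφ.cd, norm_smul, Real.norm_of_nonneg (inv_pos.2 hs).le]
      exact mul_le_mul_of_nonneg_left (hφ.d1 _) (inv_pos.2 hs).le
    have hrz : ‖r • z‖ = r * ‖z‖ := by rw [norm_smul, Real.norm_of_nonneg hr.le]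
    have hmem : z ∈ Metric.ball (0 : Ed d) (1 / r) ↔ r * ‖z‖ < 1 := by
      rw [mem_ball_zero_iff, lt_div_iff₀ hr, mul_comm]
    unfold deltaOp Ht
    rw [hrz]
    split_ifs with h
    · rw [indicator_of_mem (hmem.2 h), hgrad]
      have hz := norm_nonneg z
      have t1 := (hφ.scale x0 hs hs1).taylor x z
      have t2 : |fderiv ℝ ψ x z| ≤ s⁻¹ * N * ‖z‖ :=
        ((fderiv ℝ ψ x).le_opNorm z).trans (mul_le_mul_of_nonneg_right hfd (norm_nonneg _))
      have b1 := neg_abs_le (φ (s⁻¹ • (x + z - x0)) - φ (s⁻¹ • (x - x0)) - fderiv ℝ ψ x z)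
      rw [mul_min_of_nonneg _ _ hN, mul_min_of_nonneg _ _ (by positivity)]
      refine le_min ?_ ?_
      · have e : (s⁻¹) ^ 2 * (r⁻¹) ^ 2 * (N * (r * ‖z‖) ^ 2) = (s⁻¹) ^ 2 * N * ‖z‖ ^ 2 := by
          field_simp
        rw [e]
        change -(φ (s⁻¹ • (x + z - x0)) - φ (s⁻¹ • (x - x0)) - fderiv ℝ ψ x z) ≤ _
        have t1' : |φ (s⁻¹ • (x + z - x0)) - φ (s⁻¹ • (x - x0)) - fderiv ℝ ψ x z|
          ≤ s⁻¹ ^ 2 * N * ‖z‖ ^ 2 := t1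
        linarith
      · have e : (s⁻¹) ^ 2 * (r⁻¹) ^ 2 * (N * ((r * s) ^ 2 + r * s * (r * ‖z‖)))
            = N + s⁻¹ * N * ‖z‖ := by
          field_simp
        rw [e]
        have := neg_abs_le (ψ (x + z) - ψ x)
        have := le_abs_self (fderiv ℝ ψ x z)
        linarith
    · rw [indicator_of_notMem (fun hh => h (hmem.1 hh))]
      have e : (s⁻¹) ^ 2 * (r⁻¹) ^ 2 * (N * (r * s) ^ 2) = N := by field_simp
      rw [e]
      have := neg_abs_le (ψ (x + z) - ψ x)
      linarith
  have hint : Integrable (fun z : Ed d => (s⁻¹) ^ 2 * (r⁻¹) ^ 2 * (N * Ht (r * s) (r • z))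
      * Kresc K r z) := by
    have h1 := (integrable_comp_smul_iff (volume : Measure (Ed d))
      (fun w => Ht (r * s) w * K w) hr.ne').2 (Ht_integrable hK ht0.le ht1)
    refine (h1.const_mul ((s⁻¹) ^ 2 * (r⁻¹) ^ 2 * N * r ^ (d + 2))).congr ?_
    refine Filter.Eventually.of_forall fun z => ?_
    simp only [Kresc]
    ring
  have hle : ∫ z, max (-deltaOp ψ r x z) 0 * Kresc K r z
      ≤ ∫ z, (s⁻¹) ^ 2 * (r⁻¹) ^ 2 * (N * Ht (r * s) (r • z)) * Kresc K r z := by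
    have hkn : ∀ z, 0 ≤ Kresc K r z := fun z => mul_nonneg (by positivity) (hK.2.1 _)
    refine integral_mono_of_nonneg ?_ hint ?_
    · exact Filter.Eventually.of_forall fun z => mul_nonneg (le_max_right _ _) (hkn z)
    · exact Filter.Eventually.of_forall fun z => mul_le_mul_of_nonneg_right (hpt z) (hkn z)
  have heq : ∫ z, (s⁻¹) ^ 2 * (r⁻¹) ^ 2 * (N * Ht (r * s) (r • z)) * Kresc K r z
      = (s⁻¹) ^ 2 * (N * ∫ w, Ht (r * s) w * K w) := by
    have h1 := Measure.integral_comp_smul_of_nonneg (volume : Measure (Ed d))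
      (fun w => Ht (r * s) w * K w) r (hR := hr.le)
    have h2 : ∫ z, (s⁻¹) ^ 2 * (r⁻¹) ^ 2 * (N * Ht (r * s) (r • z)) * Kresc K r z
      = ∫ z, ((s⁻¹) ^ 2 * (r⁻¹) ^ 2 * N * r ^ (d + 2)) * (Ht (r * s) (r • z) * K (r • z)) := by
      congr 1
      funext z
      simp only [Kresc]
      ring
    rw [h2, integral_const_mul, h1, finrank_euclideanSpace_fin, smul_eq_mul]
    field_simp
    ring
  rw [heq] at hle
  have : s ^ 2 * (∫ z, max (-deltaOp ψ r x z) 0 * Kresc K r z)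
      ≤ s ^ 2 * ((s⁻¹) ^ 2 * (N * ∫ w, Ht (r * s) w * K w)) :=
    mul_le_mul_of_nonneg_left hle (by positivity)
  have e : s ^ 2 * ((s⁻¹) ^ 2 * (N * ∫ w, Ht (r * s) w * K w)) = N * ∫ w, Ht (r * s) w * K w := by
    field_simp
  rw [e] at this
  simpa [nlMinus] using this

lemma ellipticSet_nonempty {lam Lam : ℝ} (hLam : lam ≤ Lam) (d : ℕ) :
    (ellipticSet lam Lam d).Nonempty := by
  refine ⟨lam • (1 : Matrix (Fin d) (Fin d) ℝ), ?_, ?_, ?_⟩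
  · rw [Matrix.IsSymm, Matrix.transpose_smul, Matrix.transpose_one]
  · rw [sub_self]
    exact Matrix.PosSemidef.zero
  · rw [← sub_smul]
    exact Matrix.PosSemidef.one.smul (sub_nonneg.2 hLam)

lemma init_sol {d : ℕ} {lam Lam C0 : ℝ} (hLam : lam ≤ Lam) (hC0 : 0 ≤ C0)
    {K : Ed d → ℝ} (hK : KernCond K) {κ : ℝ} (hκ : 0 < κ) :
    ∃ s0, 0 < s0 ∧ s0 ≤ 1 ∧ ∀ (r : ℝ), 0 < r → r ≤ 1 → ∀ s, 0 < s → s ≤ s0 →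
      ∀ (x0 : Ed d) (f : Ed d → ℝ) (O : Set (Ed d)) (u : Ed d → ℝ),
      SupersolExtremal lam Lam C0 r K f O u →
      Sol lam Lam κ (fun y => s ^ 2 * f (x0 + s • y)) {y | x0 + s • y ∈ O}
        (fun y => u (x0 + s • y)) := by
  obtain ⟨t0, ht0, ht01, hsm⟩ := Ht_small hK (half_pos hκ)
  refine ⟨min t0 (κ / (2 * (C0 + 1))), by positivity, (min_le_left _ _).trans ht01, ?_⟩
  intro r hr hr1 s hs hss x0 f O u hu φ N c x hφ hx hle heq hc
  have hst : s ≤ t0 := hss.trans (min_le_left _ _)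
  have hs1 : s ≤ 1 := hst.trans ht01
  have hN := hφ.nonneg
  have hsc : s⁻¹ • (x0 + s • x - x0) = x := by
    rw [add_sub_cancel_left, smul_smul, inv_mul_cancel₀ hs.ne', one_smul]
  have h1 := hu (fun y => φ (s⁻¹ • (y - x0))) (hφ.scale x0 hs hs1).cd (hφ.scale x0 hs hs1).bdd
    (x0 + s • x) hx ?_ ?_
  · have hP : (s⁻¹) ^ 2 * c ≤ pucciMinus lam Lam (hess (fun y => φ (s⁻¹ • (y - x0))) (x0 + s • x)) := by
      refine le_csInf ((ellipticSet_nonempty hLam d).image _) ?_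
      rintro _ ⟨A, hA, rfl⟩
      change _ ≤ trH A _ _
      rw [trH_scale A hφ.cd, hsc]
      exact mul_le_mul_of_nonneg_left (hc A hA) (by positivity)
    have hg : ‖gradient (fun y => φ (s⁻¹ • (y - x0))) (x0 + s • x)‖ ≤ s⁻¹ * N := by
      rw [gradient, LinearIsometryEquiv.norm_map, fderiv_scale hφ.cd, norm_smul,
        Real.norm_of_nonneg (inv_pos.2 hs).le]
      exact mul_le_mul_of_nonneg_left (hφ.d1 _) (inv_pos.2 hs).le
    have hnl := nl_bound hK hr hr1 hs hs1 hφ x0 (x0 + s • x)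
    have hH := hsm (r * s) (mul_pos hr hs) (by nlinarith)
    have hg2 : C0 * r * ‖gradient (fun y => φ (s⁻¹ • (y - x0))) (x0 + s • x)‖
        ≤ C0 * (s⁻¹ * N) := by
      refine mul_le_mul (by nlinarith) hg (norm_nonneg _) hC0
    have h2 : s ^ 2 * f (x0 + s • x) ≤ s ^ 2 * (-((s⁻¹) ^ 2 * c)
        - nlMinus K r (fun y => φ (s⁻¹ • (y - x0))) (x0 + s • x) + C0 * (s⁻¹ * N)) :=
      mul_le_mul_of_nonneg_left (by linarith) (by positivity)
    have e1 : s ^ 2 * (-((s⁻¹) ^ 2 * c)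
        - nlMinus K r (fun y => φ (s⁻¹ • (y - x0))) (x0 + s • x) + C0 * (s⁻¹ * N))
        = -c + s ^ 2 * (- nlMinus K r (fun y => φ (s⁻¹ • (y - x0))) (x0 + s • x))
          + C0 * s * N := by
      field_simp
      ring
    rw [e1] at h2
    have h3 : C0 * s ≤ κ / 2 := by
      have := hss.trans (min_le_right _ _)
      rw [le_div_iff₀ (by positivity)] at this
      nlinarith
    have h4 := mul_le_mul_of_nonneg_right h3 hN
    have h5 := mul_le_mul_of_nonneg_left hH hN
    linarith
  · intro y
    have := hle (s⁻¹ • (y - x0))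
    have e : x0 + s • s⁻¹ • (y - x0) = y := by
      rw [smul_smul, mul_inv_cancel₀ hs.ne', one_smul]; abel
    simpa only [e] using this
  · simp only [hsc]
    exact heq


/-! ### The barrier -/

/-- Gaussian profile. -/
def gss {d : ℕ} (α : ℝ) (y : Ed d) : ℝ := Real.exp (-α * ‖y‖ ^ 2)

lemma gss_cd {d : ℕ} (α : ℝ) : ContDiff ℝ 2 (gss α : Ed d → ℝ) :=
  Real.contDiff_exp.comp (contDiff_const.mul (contDiff_norm_sq ℝ))

lemma gss_hasFDerivAt {d : ℕ} (α : ℝ) (y : Ed d) :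
    HasFDerivAt (gss α) ((gss α y * (-2 * α)) • innerSL ℝ y) y := by
  have h1 : HasFDerivAt (fun y : Ed d => ‖y‖ ^ 2) (2 • innerSL ℝ y) y :=
    (hasStrictFDerivAt_norm_sq y).hasFDerivAt
  have h2 := (h1.const_mul (-α)).exp
  have e : (gss α y * (-2 * α)) • innerSL ℝ y
      = Real.exp (-α * ‖y‖ ^ 2) • -α • (2 • innerSL ℝ y) := by
    ext v
    simp [gss]
    ring
  rw [e]
  exact h2

lemma gss_fderiv_apply {d : ℕ} (α : ℝ) (y w : Ed d) :
    fderiv ℝ (gss α) y w = gss α y * (-2 * α) * ⟪y, w⟫ := by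
  rw [(gss_hasFDerivAt α y).fderiv]
  simp

lemma gss_fderiv2 {d : ℕ} (α : ℝ) (y v w : Ed d) :
    fderiv ℝ (fderiv ℝ (gss α)) y v w
      = gss α y * (4 * α ^ 2 * (⟪y, v⟫ * ⟪y, w⟫) - 2 * α * ⟪v, w⟫) := by
  have h1 : fderiv ℝ (fderiv ℝ (gss α)) y v w
      = fderiv ℝ (fun x => fderiv ℝ (gss α) x w) y v := by
    rw [fderiv_clm_apply (cd_diff2 (gss_cd α) y) (differentiableAt_const w)]
    simp
  rw [h1]
  have h2 : (fun x => fderiv ℝ (gss α) x w) = fun x => gss α x * (-2 * α) * ⟪x, w⟫ := by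
    funext x; exact gss_fderiv_apply α x w
  rw [h2]
  have h3 : HasFDerivAt (fun x : Ed d => ⟪x, w⟫) (innerSL ℝ w) y := by
    have := (innerSL ℝ w).hasFDerivAt (x := y)
    refine this.congr_of_eventuallyEq (Filter.Eventually.of_forall fun x => ?_)
    simp [real_inner_comm]
  have h4 := ((gss_hasFDerivAt α y).mul_const (-2 * α)).fun_mul h3
  rw [HasFDerivAt.fderiv h4]
  simp [real_inner_comm v w]
  ring

lemma gss_trH {d : ℕ} (A : Matrix (Fin d) (Fin d) ℝ) (α : ℝ) (y : Ed d) :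
    trH A (gss α) y = gss α y * (4 * α ^ 2 * (∑ i, ∑ j, A i j * (y i * y j))
      - 2 * α * ∑ i, A i i) := by
  rw [trH_eq]
  have e : ∀ i j : Fin d, A i j * fderiv ℝ (fderiv ℝ (gss α)) y
      (EuclideanSpace.single j (1 : ℝ)) (EuclideanSpace.single i (1 : ℝ))
      = gss α y * (4 * α ^ 2) * (A i j * (y i * y j))
        - gss α y * (2 * α) * (if i = j then A i j else 0) := by
    intro i j
    rw [gss_fderiv2]
    simp only [EuclideanSpace.inner_single_right, EuclideanSpace.inner_single_left]
    by_cases h : i = j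
    · subst h; simp; ring
    · simp [h]; ring_nf
  simp only [e, Finset.sum_sub_distrib, ← Finset.mul_sum]
  simp
  ring

lemma gss_trH_lower {d : ℕ} {lam Lam α : ℝ} (hlam : 0 < lam) (hLam : lam ≤ Lam)
    (hα : α = (2 * Lam * d + 1) / lam)
    {A : Matrix (Fin d) (Fin d) ℝ} (hA : A ∈ ellipticSet lam Lam d) {y : Ed d}
    (hy : 1 / 2 ≤ ‖y‖) : gss α y * α ≤ trH A (gss α) y := by
  rw [gss_trH]
  have h0 : 0 ≤ gss α y := (Real.exp_pos _).le
  have hLam0 : 0 < Lam := hlam.trans_le hLam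
  have hα0 : 0 < α := by rw [hα]; positivity
  refine mul_le_mul_of_nonneg_left ?_ h0
  have h1 := elliptic_quad hA (fun i => y i)
  have h2 : ∑ i, y i ^ 2 = ‖y‖ ^ 2 := by
    rw [EuclideanSpace.norm_sq_eq]; simp
  rw [h2] at h1
  have h3 : ∑ i, A i i ≤ d * Lam := by
    refine (Finset.sum_le_sum fun i _ => elliptic_diag hA i).trans ?_
    simp
  have h4 : 1 / 4 ≤ ‖y‖ ^ 2 := by nlinarith
  have h5 : α * lam = 2 * Lam * d + 1 := by rw [hα]; field_simp
  have h6 : lam * (1 / 4) ≤ ∑ i, ∑ j, A i j * (y i * y j) :=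
    (mul_le_mul_of_nonneg_left h4 hlam.le).trans h1
  have h7 : 4 * α ^ 2 * (lam * (1 / 4)) ≤ 4 * α ^ 2 * (∑ i, ∑ j, A i j * (y i * y j)) :=
    mul_le_mul_of_nonneg_left h6 (by positivity)
  have h8 : 2 * α * ∑ i, A i i ≤ 2 * α * (d * Lam) :=
    mul_le_mul_of_nonneg_left h3 (by positivity)
  have h9 : 4 * α ^ 2 * (lam * (1 / 4)) = α * (α * lam) := by ring
  rw [h9, h5] at h7
  nlinarith

lemma exists_barrier (d : ℕ) {lam Lam : ℝ} (hlam : 0 < lam) (hLam : lam ≤ Lam) :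
    ∃ (b : Ed d → ℝ) (N γ β : ℝ), 0 < N ∧ 0 < γ ∧ 0 < β ∧ C2B b N ∧ (∀ y, 2 ≤ ‖y‖ → b y ≤ 0) ∧
      (∀ y, ‖y‖ ≤ 3 / 2 → β ≤ b y) ∧ (∀ y, b y ≤ 1) ∧
      ∀ A ∈ ellipticSet lam Lam d, ∀ y, 1 / 2 ≤ ‖y‖ → ‖y‖ < 3 → γ ≤ trH A b y := by
  have hLam0 : 0 < Lam := hlam.trans_le hLam
  obtain ⟨α, hα⟩ : ∃ α, α = (2 * Lam * d + 1) / lam := ⟨_, rfl⟩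
  have hα0 : 0 < α := by rw [hα]; positivity
  let χ : ContDiffBump (0 : Ed d) := ⟨3, 4, by norm_num, by norm_num⟩
  let b : Ed d → ℝ := fun y => χ y * (gss α y + (-Real.exp (-α * 4)))
  have hbcd : ContDiff ℝ 2 b := χ.contDiff.mul ((gss_cd α).add contDiff_const)
  have hbc : HasCompactSupport b := χ.hasCompactSupport.mul_right
  obtain ⟨N, hN⟩ := C2B.of_compact hbcd hbc
  have hloc : ∀ y : Ed d, ‖y‖ ≤ 3 → b y = gss α y + (-Real.exp (-α * 4)) := by
    intro y hy
    have : χ y = 1 := χ.one_of_mem_closedBall (by simpa using hy)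
    simp [b, this]
  refine ⟨b, N + 1, Real.exp (-α * 9) * α, Real.exp (-α * (9 / 4)) - Real.exp (-α * 4),
    by linarith [hN.nonneg], by positivity, ?_, hN.mono (by linarith), ?_, ?_, ?_, ?_⟩
  · rw [sub_pos, Real.exp_lt_exp]; nlinarith
  · intro y hy
    refine mul_nonpos_of_nonneg_of_nonpos χ.nonneg ?_
    have : gss α y ≤ Real.exp (-α * 4) := by
      unfold gss
      rw [Real.exp_le_exp]
      nlinarith [mul_nonneg hα0.le (show 0 ≤ ‖y‖ ^ 2 - 4 by nlinarith)]
    linarith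
  · intro y hy
    rw [hloc y (by linarith)]
    have : Real.exp (-α * (9 / 4)) ≤ gss α y := by
      unfold gss
      rw [Real.exp_le_exp]
      have h0 := norm_nonneg y
      nlinarith [mul_nonneg hα0.le (show 0 ≤ 9 / 4 - ‖y‖ ^ 2 by nlinarith)]
    linarith
  · intro y
    have h1 : gss α y ≤ 1 := by
      unfold gss
      rw [Real.exp_le_one_iff]
      nlinarith [mul_nonneg hα0.le (sq_nonneg ‖y‖)]
    have h2 := Real.exp_pos (-α * 4)
    have h3 : χ y ≤ 1 := χ.le_one
    have h4 : 0 ≤ χ y := χ.nonneg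
    simp only [b]
    nlinarith
  · intro A hA y hy1 hy2
    have hev : b =ᶠ[nhds y] fun y => gss α y + (-Real.exp (-α * 4)) := by
      have : ball (0 : Ed d) 3 ∈ nhds y := isOpen_ball.mem_nhds (by simpa using hy2)
      filter_upwards [this] with z hz
      exact hloc z (by simpa using (mem_ball_zero_iff.1 hz).le)
    rw [trH_congr A hev, trH_addConst]
    refine le_trans ?_ (gss_trH_lower hlam hLam hα hA hy1)
    refine mul_le_mul_of_nonneg_right ?_ hα0.le
    unfold gss
    rw [Real.exp_le_exp]
    have h0 := norm_nonneg y
    nlinarith [mul_nonneg hα0.le (show 0 ≤ 9 - ‖y‖ ^ 2 by nlinarith)]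

/-- Truncated linear functions. -/
lemma exists_linear (d : ℕ) : ∃ (L : Ed d → Ed d → ℝ) (N : ℝ), 0 < N ∧
    (∀ p, C2B (L p) (N * ‖p‖)) ∧ (∀ p y, |L p y| ≤ N * ‖p‖) ∧
    (∀ p y, ‖y‖ ≤ 3 → L p y = ⟪p, y⟫) := by
  let χ : ContDiffBump (0 : Ed d) := ⟨3, 4, by norm_num, by norm_num⟩
  have h : ∀ i : Fin d, ∃ N, C2B (fun y : Ed d => χ y * y i) N := by
    intro i
    refine C2B.of_compact (χ.contDiff.mul ?_) χ.hasCompactSupport.mul_right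
    exact (EuclideanSpace.proj (𝕜 := ℝ) i).contDiff
  choose Ni hNi using h
  have hNn : ∀ i, 0 ≤ Ni i := fun i => (hNi i).nonneg
  have hp : ∀ (p : Ed d) i, |p i| ≤ ‖p‖ := fun p i => by
    simpa using EuclideanSpace.norm_eq p ▸ PiLp.norm_apply_le p i
  have hsum : ∀ (p : Ed d) (s : Finset (Fin d)), C2B (fun y : Ed d => ∑ i ∈ s, p i * (χ y * y i))
      ((∑ i ∈ s, Ni i) * ‖p‖) := by
    intro p s
    induction s using Finset.induction_on with
    | empty => simpa using C2B.const (d := d) 0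
    | insert i s hi ih =>
      simp only [Finset.sum_insert hi]
      refine (((hNi i).mul (p i)).add ih).mono ?_
      rw [add_mul, mul_comm (Ni i)]
      gcongr
      · exact hNn i
      · exact hp p i
  have hS : 0 ≤ ∑ i, Ni i := Finset.sum_nonneg fun i _ => hNn i
  refine ⟨fun p y => ∑ i, p i * (χ y * y i), ∑ i, Ni i + 1, by linarith, fun p => ?_, fun p y => ?_,
    fun p y hy => ?_⟩
  · refine (hsum p Finset.univ).mono ?_
    have := norm_nonneg p
    nlinarith
  · have h1 := (hsum p Finset.univ).osc y 0
    simp at h1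
    have := norm_nonneg p
    have h2 : |∑ i, p i * (χ y * y i)| ≤ (∑ i, Ni i) * ‖p‖ := h1
    nlinarith
  · have : χ y = 1 := χ.one_of_mem_closedBall (by simpa using hy)
    simp [this, PiLp.inner_apply, mul_comm]



/-! ### Contact points and the `C^{1,1}` estimate -/

lemma lsc_min_ball {d : ℕ} {g : Ed d → ℝ} (hg : LowerSemicontinuous g) (z : Ed d) {R a : ℝ}
    (hout : ∀ y, R ≤ ‖y - z‖ → a ≤ g y) {x0 : Ed d} (hx0 : g x0 < a) :
    ∃ x, ‖x - z‖ < R ∧ (∀ y, g x ≤ g y) := by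
  have hx0R : ‖x0 - z‖ < R := by
    by_contra h
    exact absurd (hout x0 (not_lt.1 h)) (not_le.2 hx0)
  have hx0b : x0 ∈ closedBall z R := by
    rw [mem_closedBall, dist_eq_norm]; exact hx0R.le
  obtain ⟨x, hxb, hxm⟩ := (hg.lowerSemicontinuousOn (closedBall z R)).exists_isMinOn
    ⟨x0, hx0b⟩ (isCompact_closedBall z R)
  have hle : g x ≤ g x0 := hxm hx0b
  have hxR : ‖x - z‖ < R := by
    by_contra h
    have := hout x (not_lt.1 h)
    linarith
  refine ⟨x, hxR, fun y => ?_⟩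
  by_cases hy : y ∈ closedBall z R
  · exact hxm hy
  · rw [mem_closedBall, dist_eq_norm, not_le] at hy
    have := hout y hy.le
    linarith

lemma lsc_sub_cont {d : ℕ} {u g : Ed d → ℝ} (hu : LowerSemicontinuous u) (hg : Continuous g) :
    LowerSemicontinuous (fun y => u y + (-g y)) :=
  hu.add hg.neg.lowerSemicontinuous

set_option maxHeartbeats 1000000 in
lemma contact_setup (d : ℕ) {lam Lam : ℝ} (hlam : 0 < lam) (hLam : lam ≤ Lam) :
    ∃ (ψ : Ed d → Ed d → ℝ) (δ M C3 C4 κ : ℝ), 0 < δ ∧ 1 < M ∧ 0 < C3 ∧ 0 < C4 ∧ 0 < κ ∧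
      (∀ u : Ed d → ℝ, LowerSemicontinuous u → (∀ y, 0 ≤ u y) → ∀ x0, ‖x0‖ ≤ 1 → u x0 ≤ 1 →
        ∀ p, ‖p‖ ≤ δ → ∃ x m, ‖x‖ < 2 ∧ u x ≤ M ∧ u x = ψ p x + m ∧ ∀ y, ψ p y + m ≤ u y) ∧
      (∀ f u : Ed d → ℝ, LowerSemicontinuous u → Sol lam Lam κ f (ball 0 3) u →
        ∀ p0 p1 x0 x1 m0 m1 ρ, ‖p0‖ ≤ δ → ‖p1‖ ≤ δ → ‖x0‖ < 2 → ‖x1‖ < 2 →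
          u x0 = ψ p0 x0 + m0 → u x1 = ψ p1 x1 + m1 → (∀ y, ψ p0 y + m0 ≤ u y) →
          (∀ y, ψ p1 y + m1 ≤ u y) → 0 < ρ → ρ ≤ 1 / 16 → ‖x1 - x0‖ ≤ ρ →
          ∃ y, ‖y - x0‖ ≤ 8 * ρ ∧ ‖y‖ < 5 / 2 ∧
            ‖p1 - p0‖ ≤ C4 * ρ * (|f y| + if ‖y‖ < 1 / 2 then C3 else 0)) := by
  have hLam0 : 0 < Lam := hlam.trans_le hLam
  obtain ⟨b, Nb, γ, β, hNb, hγ, hβ, hb, hb2, hbβ, hb1, hbtr⟩ := exists_barrier d hlam hLam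
  obtain ⟨L, NL, hNL, hL, hLb, hLlin⟩ := exists_linear d
  obtain ⟨M0, hM0⟩ : ∃ M0, M0 = 3 / β := ⟨_, rfl⟩
  have hM0p : 0 < M0 := by rw [hM0]; positivity
  have hM0β : M0 * β = 3 := by rw [hM0]; field_simp
  have hβ1 : β ≤ 1 := (hbβ 0 (by norm_num)).trans (hb1 0)
  have hM03 : 3 ≤ M0 := by nlinarith
  obtain ⟨D, hD⟩ : ∃ D, D = (d : ℝ) ^ 2 * Lam := ⟨_, rfl⟩
  have hD0 : 0 ≤ D := by rw [hD]; positivity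
  obtain ⟨δ, hδ, hδ1, hδ2, hδ3⟩ : ∃ δ : ℝ, 0 < δ ∧ δ ≤ 1 ∧ NL * δ ≤ 1 / 4 ∧
      D * (NL * δ) ≤ M0 * γ / 2 := by
    refine ⟨min 1 (min (1 / (4 * NL)) (M0 * γ / (2 * ((D + 1) * NL)))), by positivity,
      min_le_left _ _, ?_, ?_⟩
    · have : min 1 (min (1 / (4 * NL)) (M0 * γ / (2 * ((D + 1) * NL)))) ≤ 1 / (4 * NL) :=
        (min_le_right _ _).trans (min_le_left _ _)
      calc _ ≤ NL * (1 / (4 * NL)) := mul_le_mul_of_nonneg_left this hNL.le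
        _ = 1 / 4 := by field_simp
    · have : min 1 (min (1 / (4 * NL)) (M0 * γ / (2 * ((D + 1) * NL))))
          ≤ M0 * γ / (2 * ((D + 1) * NL)) := (min_le_right _ _).trans (min_le_right _ _)
      calc _ ≤ (D + 1) * (NL * (M0 * γ / (2 * ((D + 1) * NL)))) := by
            gcongr; linarith
        _ = M0 * γ / 2 := by field_simp
  obtain ⟨N1, hN1⟩ : ∃ N1, N1 = M0 * Nb + NL := ⟨_, rfl⟩
  have hN1p : 0 < N1 := by rw [hN1]; positivity
  obtain ⟨κ, hκ, hκ1, hκ2⟩ : ∃ κ : ℝ, 0 < κ ∧ κ * Nb ≤ γ / 2 ∧ κ * N1 ≤ M0 * γ / 2 := by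
    refine ⟨min (γ / (2 * Nb)) (M0 * γ / (2 * N1)), by positivity, ?_, ?_⟩
    · calc _ ≤ (γ / (2 * Nb)) * Nb := mul_le_mul_of_nonneg_right (min_le_left _ _) hNb.le
        _ = γ / 2 := by field_simp
    · calc _ ≤ (M0 * γ / (2 * N1)) * N1 := mul_le_mul_of_nonneg_right (min_le_right _ _) hN1p.le
        _ = _ := by field_simp
  have hψC : ∀ p, ‖p‖ ≤ δ → C2B (fun y => M0 * b y + L p y) (M0 * Nb + NL * δ) := by
    intro p hp
    have h1 := hb.mul M0
    rw [abs_of_pos hM0p] at h1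
    exact h1.add ((hL p).mono (mul_le_mul_of_nonneg_left hp hNL.le))
  have hLδ : ∀ p y, ‖p‖ ≤ δ → |L p y| ≤ 1 / 4 := fun p y hp =>
    (hLb p y).trans ((mul_le_mul_of_nonneg_left hp hNL.le).trans hδ2)
  refine ⟨fun p y => M0 * b y + L p y, δ, M0 + 1 / 4, M0 * γ + M0 * (D * Nb), 8 / γ, κ,
    hδ, by linarith, by positivity, by positivity, hκ, ?_, ?_⟩
  · intro u hu hu0 x0 hx0 hux0 p hp
    have hc : Continuous (fun y => M0 * b y + L p y) := (hψC p hp).cd.continuous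
    have hbx0 := hbβ x0 (by linarith)
    obtain ⟨x, hx2, hxm⟩ := lsc_min_ball (lsc_sub_cont hu hc) 0 (R := 2) (a := -(1 / 4))
      (fun y hy => by
        have h1 := hb2 y (by simpa using hy)
        have h2 := abs_le.1 (hLδ p y hp)
        have h3 := hu0 y
        have h4 : M0 * b y ≤ 0 := mul_nonpos_of_nonneg_of_nonpos hM0p.le h1
        linarith) (x0 := x0) (by
        have h2 := abs_le.1 (hLδ p x0 hp)
        have h4 : M0 * β ≤ M0 * b x0 := mul_le_mul_of_nonneg_left hbx0 hM0p.le
        linarith)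
    refine ⟨x, u x - (M0 * b x + L p x), by simpa using hx2, ?_, by ring, fun y => ?_⟩
    · have h1 := hxm x0
      have h2 := abs_le.1 (hLδ p x0 hp)
      have h2' := abs_le.1 (hLδ p x hp)
      have h4 : M0 * β ≤ M0 * b x0 := mul_le_mul_of_nonneg_left hbx0 hM0p.le
      have h5 : M0 * b x ≤ M0 * 1 := mul_le_mul_of_nonneg_left (hb1 x) hM0p.le
      linarith
    · have := hxm y
      linarith
  · intro f u hu hsol p0 p1 x0 x1 m0 m1 ρ hp0 hp1 hx0 hx1 he0 he1 hle0 hle1 hρ hρ16 hx01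
    by_cases hq : p1 - p0 = 0
    · refine ⟨x0, by simp; positivity, by linarith, ?_⟩
      rw [hq, norm_zero]
      have : (0 : ℝ) ≤ if ‖x0‖ < 1 / 2 then M0 * γ + M0 * (D * Nb) else 0 := by
        split_ifs <;> positivity
      positivity
    obtain ⟨q, hqd⟩ : ∃ q, q = p1 - p0 := ⟨_, rfl⟩
    rw [← hqd] at hq ⊢
    have hqn : 0 < ‖q‖ := norm_pos_iff.2 hq
    obtain ⟨e, hed⟩ : ∃ e, e = ‖q‖⁻¹ • q := ⟨_, rfl⟩
    have hen : ‖e‖ = 1 := by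
      rw [hed, norm_smul, norm_inv, norm_norm]; field_simp
    have hqe : ⟪q, e⟫ = ‖q‖ := by
      rw [hed, real_inner_smul_right, real_inner_self_eq_norm_sq]; field_simp
    obtain ⟨z0, hz0⟩ : ∃ z0, z0 = x1 + (2 * ρ) • e := ⟨_, rfl⟩
    have hz0x1 : ‖z0 - x1‖ = 2 * ρ := by
      rw [hz0, add_sub_cancel_left, norm_smul, hen, Real.norm_of_nonneg (by positivity)]; ring
    have h2ρ : (0 : ℝ) < 2 * ρ := by positivity
    obtain ⟨ξ, hξ⟩ : ∃ ξ : Ed d → Ed d, ξ = fun y => (2 * ρ)⁻¹ • (y - z0) := ⟨_, rfl⟩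
    have hξn : ∀ y, ‖y - z0‖ = 2 * ρ * ‖ξ y‖ := by
      intro y
      rw [hξ]; simp only
      rw [norm_smul, Real.norm_of_nonneg (by positivity)]; field_simp
    have hQ : C2B (fun y => b (ξ y)) (((2 * ρ)⁻¹) ^ 2 * Nb) := by
      rw [hξ]; exact hb.scale z0 h2ρ (by linarith)
    have hQ' := hQ.mul (‖q‖ * ρ)
    rw [abs_of_pos (by positivity : 0 < ‖q‖ * ρ)] at hQ'
    have hφ := (hψC p0 hp0).add hQ'
    -- the linear lower bound
    have hlin : ∀ y, ‖y‖ ≤ 3 → M0 * b y + L p0 y + m0 + ⟪q, y - x1⟫ ≤ u y := by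
      intro y hy
      have a1 := hle1 y
      have a2 := hle0 x1
      have a3 := he1
      simp only at a1 a2 a3
      rw [hLlin p1 y hy] at a1
      rw [hLlin p0 y hy]
      rw [hLlin p1 x1 (by linarith)] at a3
      rw [hLlin p0 x1 (by linarith)] at a2
      have : ⟪q, y - x1⟫ = ⟪p1, y⟫ - ⟪p0, y⟫ - ⟪p1, x1⟫ + ⟪p0, x1⟫ := by
        rw [hqd, inner_sub_right, inner_sub_left, inner_sub_left]; ring
      rw [this]
      linarith
    have hx0z0 : ‖x0 - z0‖ ≤ 3 * ρ := by
      have : x0 - z0 = -(x1 - x0) - (z0 - x1) := by abel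
      rw [this]
      refine (norm_sub_le _ _).trans ?_
      rw [norm_neg]; linarith
    obtain ⟨y, hyR, hym⟩ := lsc_min_ball (lsc_sub_cont hu hφ.cd.continuous) z0 (R := 4 * ρ)
      (a := m0) (fun y hy => by
        rw [hξn] at hy
        have h1 : 2 ≤ ‖ξ y‖ := le_of_mul_le_mul_left (by linarith) h2ρ
        have h2 := hb2 _ h1
        have h3 : ‖q‖ * ρ * b (ξ y) ≤ 0 :=
          mul_nonpos_of_nonneg_of_nonpos (by positivity) h2
        have h4 := hle0 y
        simp only at h4
        linarith) (x0 := x0) (by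
        rw [hξn] at hx0z0
        have h1 : ‖ξ x0‖ ≤ 3 / 2 := le_of_mul_le_mul_left (by linarith) h2ρ
        have h2 := hbβ _ h1
        have h3 : 0 < ‖q‖ * ρ * b (ξ x0) := mul_pos (by positivity) (by linarith)
        simp only at he0
        linarith)
    have hmin0 : u y + -(M0 * b y + L p0 y + ‖q‖ * ρ * b (ξ y)) < m0 := by
      refine (hym x0).trans_lt ?_
      rw [hξn] at hx0z0
      have h1 : ‖ξ x0‖ ≤ 3 / 2 := le_of_mul_le_mul_left (by linarith) h2ρ
      have h2 := hbβ _ h1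
      have h3 : 0 < ‖q‖ * ρ * b (ξ x0) := mul_pos (by positivity) (by linarith)
      simp only at he0
      linarith
    have hyx0 : ‖y - x0‖ ≤ 7 * ρ := by
      have : y - x0 = (y - z0) - (x0 - z0) := by abel
      rw [this]
      refine (norm_sub_le _ _).trans ?_
      linarith
    have hy52 : ‖y‖ < 5 / 2 := by
      have : ‖y‖ ≤ ‖y - x0‖ + ‖x0‖ := by
        simpa using norm_add_le (y - x0) x0
      linarith
    have hξ2 : ‖ξ y‖ < 3 := by
      rw [hξn] at hyR
      exact lt_of_mul_lt_mul_left (by linarith) h2ρ.le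
    have hξ1 : 1 / 2 ≤ ‖ξ y‖ := by
      by_contra hcon
      have hcon := not_le.1 hcon
      have h1 : ‖y - z0‖ ≤ ρ := by
        rw [hξn]
        have := mul_le_mul_of_nonneg_left hcon.le h2ρ.le
        linarith
      have h2 := hlin y (by linarith)
      have h3 : ⟪q, y - x1⟫ = ⟪q, y - z0⟫ + 2 * ρ * ‖q‖ := by
        have : y - x1 = (y - z0) + (2 * ρ) • e := by rw [hz0]; abel
        rw [this, inner_add_right, real_inner_smul_right, hqe]
      have h4 : -(‖q‖ * ρ) ≤ ⟪q, y - z0⟫ := by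
        have := abs_le.1 (abs_real_inner_le_norm q (y - z0))
        have h5 : ‖q‖ * ‖y - z0‖ ≤ ‖q‖ * ρ := mul_le_mul_of_nonneg_left h1 hqn.le
        linarith
      have h6 : ‖q‖ * ρ * b (ξ y) ≤ ‖q‖ * ρ * 1 :=
        mul_le_mul_of_nonneg_left (hb1 _) (by positivity)
      linarith
    obtain ⟨m, hm⟩ : ∃ m, m = u y + -(M0 * b y + L p0 y + ‖q‖ * ρ * b (ξ y)) := ⟨_, rfl⟩
    refine ⟨y, by linarith, hy52, ?_⟩
    have key := hsol _ _ ((if ‖y‖ < 1 / 2 then -(M0 * (D * Nb)) else M0 * γ) - D * (NL * δ)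
      + ‖q‖ * ρ * (((2 * ρ)⁻¹) ^ 2 * γ)) y (hφ.addConst m) (by simp; linarith)
      (fun x => by have := hym x; rw [hm]; linarith) (by rw [hm]; ring) ?_
    · have e1 : ‖q‖ * ρ * (((2 * ρ)⁻¹) ^ 2 * γ) = γ * (‖q‖ / (4 * ρ)) := by
        field_simp; ring
      have e2 : ‖q‖ * ρ * (((2 * ρ)⁻¹) ^ 2 * Nb) = Nb * (‖q‖ / (4 * ρ)) := by
        field_simp; ring
      rw [e1, e2] at key
      obtain ⟨T, hT⟩ : ∃ T, T = ‖q‖ / (4 * ρ) := ⟨_, rfl⟩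
      have hT0 : 0 < T := by rw [hT]; positivity
      rw [← hT] at key
      have e3 : ‖q‖ = 4 * ρ * T := by rw [hT]; field_simp
      have e4 : κ * Nb * T ≤ γ / 2 * T := mul_le_mul_of_nonneg_right hκ1 hT0.le
      have e5 : κ * (M0 * Nb + NL * δ) ≤ κ * N1 := by
        rw [hN1]
        refine mul_le_mul_of_nonneg_left ?_ hκ.le
        nlinarith
      have e6 := neg_abs_le (f y)
      have e7 : γ * T / 2 ≤ |f y| + if ‖y‖ < 1 / 2 then M0 * γ + M0 * (D * Nb) else 0 := by
        split_ifs at key ⊢ <;> nlinarith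
      rw [e3]
      have e8 : 4 * ρ * T = 8 / γ * ρ * (γ * T / 2) := by field_simp; ring
      rw [e8]
      exact mul_le_mul_of_nonneg_left e7 (by positivity)
    · intro A hA
      rw [trH_addConst, trH_add A (hψC p0 hp0).cd hQ'.cd,
        trH_add A (contDiff_const.mul hb.cd) (hL p0).cd, trH_mul A hb.cd, trH_mul A hQ.cd]
      have t1 : trH A (fun y => b (ξ y)) y = ((2 * ρ)⁻¹) ^ 2 * trH A b (ξ y) := by
        rw [hξ]; exact trH_scale A hb.cd z0 (2 * ρ) y
      rw [t1]
      have t2 := hbtr A hA (ξ y) hξ1 hξ2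
      have t3 := abs_le.1 (trH_bound hlam hA ((hL p0).mono
        (mul_le_mul_of_nonneg_left hp0 hNL.le)) y)
      rw [← hD] at t3
      have t4 : ‖q‖ * ρ * (((2 * ρ)⁻¹) ^ 2 * γ) ≤ ‖q‖ * ρ * (((2 * ρ)⁻¹) ^ 2 * trH A b (ξ y)) := by
        gcongr
      have t5 : (if ‖y‖ < 1 / 2 then -(M0 * (D * Nb)) else M0 * γ) ≤ M0 * trH A b y := by
        split_ifs with h
        · have t6 := abs_le.1 (trH_bound hlam hA hb y)
          rw [← hD] at t6
          have := mul_le_mul_of_nonneg_left t6.1 hM0p.le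
          linarith
        · exact mul_le_mul_of_nonneg_left (hbtr A hA y (not_lt.1 h) (by linarith)) hM0p.le
      linarith


/-! ### Measure estimate for the contact set -/

lemma contact_measure {d : ℕ} (X : Ed d → Ed d) (P : Set (Ed d)) (ν : Measure (Ed d))
    [IsFiniteMeasure ν] {C : ℝ≥0∞} (hC : C ≠ ⊤)
    (h : ∀ p0 ∈ P, ∃ ρ0 > 0, ∀ ρ, 0 < ρ → ρ < ρ0 →
      volume {p | p ∈ P ∧ X p ∈ closedBall (X p0) ρ} ≤ C * ν (closedBall (X p0) ρ)) :
    volume P ≤ C * ν (X '' P) := by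
  refine ENNReal.le_of_forall_pos_le_add fun ε hε _ => ?_
  obtain ⟨η, hη, hηε⟩ : ∃ η : ℝ≥0∞, η ≠ 0 ∧ C * η ≤ ε := by
    rcases eq_or_ne C 0 with rfl | hC0
    · exact ⟨1, one_ne_zero, by simp⟩
    · refine ⟨ε / C, ?_, ENNReal.mul_div_le⟩
      exact (ENNReal.div_pos (by simpa using hε.ne') hC).ne'
  obtain ⟨t, r, htc, hts, htr, hcov, hsum⟩ :=
    Besicovitch.exists_closedBall_covering_tsum_measure_le ν hη
      (fun x => {ρ | 0 < ρ ∧ volume {p | p ∈ P ∧ X p ∈ closedBall x ρ} ≤ C * ν (closedBall x ρ)})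
      (X '' P) (by
        rintro x ⟨p0, hp0, rfl⟩ δ hδ
        obtain ⟨ρ0, hρ0, hh⟩ := h p0 hp0
        have hm : 0 < min ρ0 δ := lt_min hρ0 hδ
        have l1 := min_le_left ρ0 δ
        have l2 := min_le_right ρ0 δ
        refine ⟨min ρ0 δ / 2, ⟨by simpa using hm, hh _ (by linarith) (by linarith)⟩,
          by simpa using hm, by linarith⟩)
  have hsub : P ⊆ ⋃ x ∈ t, {p | p ∈ P ∧ X p ∈ closedBall x (r x)} := by
    intro p hp
    have := hcov (mem_image_of_mem X hp)
    simp only [mem_iUnion] at this ⊢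
    obtain ⟨x, hx, hxp⟩ := this
    exact ⟨x, hx, hp, hxp⟩
  calc volume P ≤ volume (⋃ x ∈ t, {p | p ∈ P ∧ X p ∈ closedBall x (r x)}) := measure_mono hsub
    _ ≤ ∑' x : t, volume {p | p ∈ P ∧ X p ∈ closedBall (x : Ed d) (r x)} :=
        measure_biUnion_le volume htc _
    _ ≤ ∑' x : t, C * ν (closedBall (x : Ed d) (r x)) :=
        ENNReal.tsum_le_tsum fun x => (htr x x.2).2
    _ = C * ∑' x : t, ν (closedBall (x : Ed d) (r x)) := ENNReal.tsum_mul_left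
    _ ≤ C * (ν (X '' P) + η) := by gcongr
    _ = C * ν (X '' P) + C * η := mul_add _ _ _
    _ ≤ _ := by gcongr

lemma ennreal_add3_pow (a b c : ℝ≥0∞) (n : ℕ) :
    (a + b + c) ^ n ≤ 3 ^ n * (a ^ n + b ^ n + c ^ n) := by
  have h1 : a + b + c ≤ 3 * max a (max b c) := by
    have e : (3 : ℝ≥0∞) * max a (max b c) = max a (max b c) + max a (max b c) + max a (max b c) := by
      ring
    rw [e]
    gcongr
    · exact le_max_left _ _
    · exact (le_max_left _ _).trans (le_max_right _ _)
    · exact (le_max_right _ _).trans (le_max_right _ _)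
  calc (a + b + c) ^ n ≤ (3 * max a (max b c)) ^ n := by gcongr
    _ = 3 ^ n * (max a (max b c)) ^ n := mul_pow _ _ _
    _ ≤ _ := by
      gcongr
      rcases le_total b c with h | h
      · rw [max_eq_right h]
        rcases le_total a c with h' | h'
        · rw [max_eq_right h']; exact le_add_self
        · rw [max_eq_left h', add_assoc]; exact le_self_add
      · rw [max_eq_left h]
        rcases le_total a b with h' | h'
        · rw [max_eq_right h']; exact le_add_self.trans le_self_add
        · rw [max_eq_left h', add_assoc]; exact le_self_add

lemma vol_closedBall {d : ℕ} (x : Ed d) {r : ℝ} (hr : 0 ≤ r) :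
    volume (closedBall x r) = ENNReal.ofReal r ^ d * volume (ball (0 : Ed d) 1) := by
  rw [Measure.addHaar_closedBall volume x hr, ENNReal.ofReal_pow hr]
  simp

lemma vol_ball {d : ℕ} (x : Ed d) {r : ℝ} (hr : 0 < r) :
    volume (ball x r) = ENNReal.ofReal r ^ d * volume (ball (0 : Ed d) 1) := by
  rw [Measure.addHaar_ball_of_pos volume x hr, ENNReal.ofReal_pow hr.le]
  simp


lemma dens_bound {d : ℕ} (hd : 1 ≤ d) (f : Ed d → ℝ) (hf : Measurable f) (τ C3 : ℝ)
    (T : Set (Ed d)) (hT : MeasurableSet T) :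
    ((volume.restrict (ball (0 : Ed d) 3)).withDensity (fun x =>
      (ENNReal.ofReal |f x| + ENNReal.ofReal (2 * τ)
        + (ball (0 : Ed d) 1).indicator (fun _ => ENNReal.ofReal C3) x) ^ d)) T
    ≤ 3 ^ d * ((∫⁻ x in ball (0 : Ed d) 3, ENNReal.ofReal |f x| ^ d)
        + ENNReal.ofReal (2 * τ) ^ d * volume (ball (0 : Ed d) 3)
        + ENNReal.ofReal C3 ^ d * volume (T ∩ ball (0 : Ed d) 1)) := by
  have hm1 : Measurable (fun x => ENNReal.ofReal |f x|) := by fun_prop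
  rw [withDensity_apply _ hT]
  set ν := volume.restrict (ball (0 : Ed d) 3) with hν
  calc _ ≤ ∫⁻ x in T, 3 ^ d * ((ENNReal.ofReal |f x|) ^ d + ENNReal.ofReal (2 * τ) ^ d
        + ((ball (0 : Ed d) 1).indicator (fun _ => ENNReal.ofReal C3) x) ^ d) ∂ν :=
        lintegral_mono fun x => ennreal_add3_pow _ _ _ d
    _ = 3 ^ d * ((∫⁻ x in T, (ENNReal.ofReal |f x|) ^ d ∂ν)
        + (∫⁻ x in T, ENNReal.ofReal (2 * τ) ^ d ∂ν)
        + (∫⁻ x in T, ((ball (0 : Ed d) 1).indicator (fun _ => ENNReal.ofReal C3 ^ d) x) ∂ν)) := by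
        have e : ∀ x, ((ball (0 : Ed d) 1).indicator (fun _ => ENNReal.ofReal C3) x) ^ d
            = (ball (0 : Ed d) 1).indicator (fun _ => ENNReal.ofReal C3 ^ d) x := by
          intro x
          by_cases hx : x ∈ ball (0 : Ed d) 1
          · simp only [indicator_of_mem hx]
          · simp only [indicator_of_notMem hx]; exact zero_pow (by omega)
        simp only [e]
        rw [lintegral_const_mul' _ _ (by simp), lintegral_add_left (by fun_prop),
          lintegral_add_left (by fun_prop)]
    _ ≤ _ := by
        refine mul_le_mul_right (add_le_add (add_le_add ?_ ?_) ?_) _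
        · exact setLIntegral_le_lintegral _ _
        · rw [setLIntegral_const, hν]
          refine mul_le_mul_right ?_ _
          rw [Measure.restrict_apply hT]
          exact measure_mono inter_subset_right
        · rw [lintegral_indicator measurableSet_ball, setLIntegral_const]
          refine mul_le_mul_right ?_ _
          rw [Measure.restrict_apply measurableSet_ball, inter_comm T]
          exact Measure.restrict_apply_le _ _

lemma local_contact {d : ℕ} (f : Ed d → ℝ) (hfc : ContinuousOn f (ball 0 3))
    {τ C3 C4 δ : ℝ} (hτ : 0 < τ) (hC3 : 0 < C3) (hC4 : 0 < C4) (X : Ed d → Ed d)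
    (hX2 : ∀ p, ‖p‖ ≤ δ → ‖X p‖ < 2)
    (hX : ∀ p0 p1, ‖p0‖ ≤ δ → ‖p1‖ ≤ δ → ∀ ρ, 0 < ρ → ρ ≤ 1 / 16 → ‖X p1 - X p0‖ ≤ ρ →
          ∃ y, ‖y - X p0‖ ≤ 8 * ρ ∧ ‖y‖ < 5 / 2 ∧
            ‖p1 - p0‖ ≤ C4 * ρ * (|f y| + if ‖y‖ < 1 / 2 then C3 else 0))
    (p0 : Ed d) (hp0 : ‖p0‖ ≤ δ) :
    ∃ ρ0 > 0, ∀ ρ, 0 < ρ → ρ < ρ0 →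
      volume {p | p ∈ closedBall (0 : Ed d) δ ∧ X p ∈ closedBall (X p0) ρ} ≤
      ENNReal.ofReal C4 ^ d * ((volume.restrict (ball (0 : Ed d) 3)).withDensity (fun x =>
      (ENNReal.ofReal |f x| + ENNReal.ofReal (2 * τ)
        + (ball (0 : Ed d) 1).indicator (fun _ => ENNReal.ofReal C3) x) ^ d))
        (closedBall (X p0) ρ) := by
  have hx2 := hX2 p0 hp0
  have hc : ContinuousAt f (X p0) :=
    hfc.continuousAt (isOpen_ball.mem_nhds (by simp; linarith))
  obtain ⟨η, hη, hηf⟩ := Metric.continuousAt_iff.1 hc τ hτ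
  refine ⟨min (1 / 64) (η / 16), by positivity, fun ρ hρ hρ0 => ?_⟩
  have hρ1 : ρ < 1 / 64 := hρ0.trans_le (min_le_left _ _)
  have hρ2 : ρ < η / 16 := hρ0.trans_le (min_le_right _ _)
  have hosc : ∀ y, ‖y - X p0‖ ≤ 8 * ρ → |f y - f (X p0)| < τ := fun y hy => by
    have := hηf (x := y) (by rw [dist_eq_norm]; linarith)
    rwa [Real.dist_eq] at this
  obtain ⟨A, hA⟩ : ∃ A, A = |f (X p0)| + τ + if ‖X p0‖ < 3 / 4 then C3 else 0 := ⟨_, rfl⟩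
  have hif : (0 : ℝ) ≤ if ‖X p0‖ < 3 / 4 then C3 else 0 := by split_ifs <;> linarith
  have hA0 : 0 < A := by rw [hA]; positivity
  have hsub : {p | p ∈ closedBall (0 : Ed d) δ ∧ X p ∈ closedBall (X p0) ρ} ⊆
      closedBall p0 (C4 * ρ * A) := by
    rintro p ⟨hp, hXp⟩
    rw [mem_closedBall, dist_eq_norm] at hXp
    obtain ⟨y, hy1, hy2, hy3⟩ := hX p0 p hp0 (by simpa using hp) ρ hρ (by linarith) hXp
    rw [mem_closedBall, dist_eq_norm]
    refine hy3.trans (mul_le_mul_of_nonneg_left ?_ (by positivity))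
    rw [hA]
    have h1 : |f y| ≤ |f (X p0)| + τ := by
      have := abs_sub_abs_le_abs_sub (f y) (f (X p0))
      linarith [hosc y hy1]
    have h2 : (if ‖y‖ < 1 / 2 then C3 else 0) ≤ if ‖X p0‖ < 3 / 4 then C3 else 0 := by
      by_cases h : ‖y‖ < 1 / 2
      · have : ‖X p0‖ ≤ ‖y‖ + ‖y - X p0‖ := by
          have := norm_sub_le y (y - X p0)
          simpa using this
        rw [if_pos h, if_pos (by linarith)]
      · rw [if_neg h]; exact hif
    linarith
  have hlow : ∀ y ∈ closedBall (X p0) ρ, ENNReal.ofReal A ^ d ≤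
      (ENNReal.ofReal |f y| + ENNReal.ofReal (2 * τ)
        + (ball (0 : Ed d) 1).indicator (fun _ => ENNReal.ofReal C3) y) ^ d := by
    intro y hy
    rw [mem_closedBall, dist_eq_norm] at hy
    refine pow_le_pow_left' ?_ d
    have h1 : |f (X p0)| + τ ≤ |f y| + 2 * τ := by
      have := abs_sub_abs_le_abs_sub (f (X p0)) (f y)
      rw [abs_sub_comm] at this
      linarith [hosc y (by linarith)]
    rw [hA, ENNReal.ofReal_add (by positivity) hif]
    rw [← ENNReal.ofReal_add (abs_nonneg _) (by positivity)]
    refine add_le_add (ENNReal.ofReal_le_ofReal h1) ?_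
    by_cases h : ‖X p0‖ < 3 / 4
    · rw [if_pos h, indicator_of_mem]
      have : ‖y‖ ≤ ‖y - X p0‖ + ‖X p0‖ := by
        simpa using norm_add_le (y - X p0) (X p0)
      simp; linarith
    · rw [if_neg h]; simp
  calc _ ≤ volume (closedBall p0 (C4 * ρ * A)) := measure_mono hsub
    _ = ENNReal.ofReal C4 ^ d * (ENNReal.ofReal A ^ d * volume (closedBall (X p0) ρ)) := by
        rw [vol_closedBall _ (by positivity), vol_closedBall _ hρ.le,
          ENNReal.ofReal_mul (by positivity), ENNReal.ofReal_mul (by positivity)]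
        ring
    _ ≤ _ := by
        gcongr
        rw [withDensity_apply _ measurableSet_closedBall, Measure.restrict_restrict measurableSet_closedBall,
          inter_eq_left.2]
        · rw [← setLIntegral_const]
          exact setLIntegral_mono' measurableSet_closedBall hlow
        · intro y hy
          rw [mem_closedBall, dist_eq_norm] at hy
          have : ‖y‖ ≤ ‖y - X p0‖ + ‖X p0‖ := by
            simpa using norm_add_le (y - X p0) (X p0)
          simp; linarith

lemma vol_ball_ne_top {d : ℕ} (x : Ed d) (r : ℝ) : volume (ball x r) ≠ ⊤ := measure_ball_lt_top.ne

lemma lsc_measurableSet_le {d : ℕ} {u : Ed d → ℝ} (hu : LowerSemicontinuous u) (a : ℝ) :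
    MeasurableSet {x | u x ≤ a} := measurableSet_le hu.measurable measurable_const

lemma ofReal_combine {a e t w c v : ℝ} (ha : 0 ≤ a) (he : 0 ≤ e) (ht : 0 ≤ t) (hw : 0 ≤ w)
    (hc : 0 ≤ c) (hv : 0 ≤ v) {d : ℕ} :
    ENNReal.ofReal a ^ d * (3 ^ d * (ENNReal.ofReal e ^ d
          + ENNReal.ofReal t ^ d * (3 ^ d * ENNReal.ofReal w)
          + ENNReal.ofReal c ^ d * ENNReal.ofReal v))
      = ENNReal.ofReal ((3 * a) ^ d * (e ^ d + t ^ d * (3 ^ d * w) + c ^ d * v)) := by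
  have h3 : (3 : ℝ≥0∞) = ENNReal.ofReal 3 := by simp
  rw [h3, ← ENNReal.ofReal_pow ha, ← ENNReal.ofReal_pow he, ← ENNReal.ofReal_pow ht,
    ← ENNReal.ofReal_pow hc, ← ENNReal.ofReal_pow (by norm_num),
    ← ENNReal.ofReal_mul (by positivity), ← ENNReal.ofReal_mul (by positivity),
    ← ENNReal.ofReal_mul (by positivity), ← ENNReal.ofReal_add (by positivity) (by positivity),
    ← ENNReal.ofReal_add (by positivity) (by positivity), ← ENNReal.ofReal_mul (by positivity),
    ← ENNReal.ofReal_mul (by positivity)]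
  congr 1
  rw [mul_pow]
  ring

set_option maxHeartbeats 1000000 in
lemma point_to_measure {d : ℕ} (hd : 1 ≤ d) {lam Lam : ℝ} (hlam : 0 < lam) (hLam : lam ≤ Lam) :
    ∃ κ M μ ε0 : ℝ, 0 < κ ∧ 1 < M ∧ 0 < μ ∧ μ < 1 ∧ 0 < ε0 ∧
      ∀ f u : Ed d → ℝ, Measurable f → ContinuousOn f (ball 0 3) →
        (∫⁻ x in ball (0 : Ed d) 3, ENNReal.ofReal |f x| ^ d) ≤ ENNReal.ofReal ε0 ^ d →
        LowerSemicontinuous u → (∀ y, 0 ≤ u y) → Sol lam Lam κ f (ball 0 3) u →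
        ∀ x0, ‖x0‖ ≤ 1 → u x0 ≤ 1 →
        ENNReal.ofReal μ * volume (ball (0 : Ed d) 1) ≤
          volume ({x | u x ≤ M} ∩ ball (0 : Ed d) 1) := by
  obtain ⟨ψ, δ, M, C3, C4, κ, hδ, hM, hC3, hC4, hκ, hcon, hC11⟩ := contact_setup d hlam hLam
  obtain ⟨w, hw⟩ : ∃ w, w = (volume (ball (0 : Ed d) 1)).toReal := ⟨_, rfl⟩
  have hwv : volume (ball (0 : Ed d) 1) = ENNReal.ofReal w := by
    rw [hw, ENNReal.ofReal_toReal (vol_ball_ne_top _ _)]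
  have hw0 : 0 < w := by
    rw [hw]
    exact ENNReal.toReal_pos (measure_ball_pos volume _ one_pos).ne' (vol_ball_ne_top _ _)
  obtain ⟨τ, hτd⟩ : ∃ τ, τ = δ / (72 * C4) := ⟨_, rfl⟩
  have hτ : 0 < τ := by rw [hτd]; positivity
  obtain ⟨ε0, hε0d⟩ : ∃ ε0, ε0 = δ * min 1 w / (12 * C4) := ⟨_, rfl⟩
  have hmw : 0 < min 1 w := lt_min one_pos hw0
  have hε0 : 0 < ε0 := by rw [hε0d]; positivity
  have q4 : (1 / 4 : ℝ) ^ d ≤ 1 / 4 := pow_le_of_le_one (by norm_num) (by norm_num) (by omega)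
  have hτ1 : (3 * C4) ^ d * ((2 * τ) ^ d * (3 ^ d * w)) ≤ δ ^ d * w / 4 := by
    have : (3 * C4) ^ d * ((2 * τ) ^ d * (3 ^ d * w)) = δ ^ d * w * (1 / 4) ^ d := by
      have e : 3 * C4 * (2 * τ) * 3 = δ * (1 / 4) := by rw [hτd]; field_simp; ring
      calc _ = (3 * C4 * (2 * τ) * 3) ^ d * w := by rw [mul_pow _ 3, mul_pow _ (2 * τ)]; ring
        _ = _ := by rw [e, mul_pow]; ring
    rw [this]
    have : 0 ≤ δ ^ d * w := by positivity
    nlinarith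
  have hε1 : (3 * C4) ^ d * ε0 ^ d ≤ δ ^ d * w / 4 := by
    have : (3 * C4) ^ d * ε0 ^ d = δ ^ d * (min 1 w ^ d * (1 / 4) ^ d) := by
      rw [← mul_pow, ← mul_pow, ← mul_pow, hε0d]
      congr 1
      field_simp; ring
    rw [this]
    have h1 : min 1 w ^ d ≤ w :=
      (pow_le_of_le_one hmw.le (min_le_left _ _) (by omega)).trans (min_le_right _ _)
    have h2 : min 1 w ^ d * (1 / 4) ^ d ≤ w * (1 / 4) := by gcongr
    have : 0 < δ ^ d := by positivity
    nlinarith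
  refine ⟨κ, M, min (1 / 2) (δ ^ d / (2 * ((3 * C4) ^ d * C3 ^ d))), ε0, hκ, hM, by positivity,
    (min_le_left _ _).trans_lt (by norm_num), hε0, ?_⟩
  intro f u hf hfc hfi hu hu0 hsol x0 hx0 hux0
  choose! X m hX2 hXM hXe hXle using hcon u hu hu0 x0 hx0 hux0
  have hT : MeasurableSet ({x | u x ≤ M} ∩ ball (0 : Ed d) 2) :=
    (lsc_measurableSet_le hu M).inter measurableSet_ball
  have hfin : IsFiniteMeasure ((volume.restrict (ball (0 : Ed d) 3)).withDensity (fun x =>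
      (ENNReal.ofReal |f x| + ENNReal.ofReal (2 * τ)
        + (ball (0 : Ed d) 1).indicator (fun _ => ENNReal.ofReal C3) x) ^ d)) := by
    refine ⟨(dens_bound hd f hf τ C3 univ MeasurableSet.univ).trans_lt ?_⟩
    have h1 := hfi.trans_lt (by finiteness : ENNReal.ofReal ε0 ^ d < ⊤)
    have h2 := vol_ball_ne_top (0 : Ed d) 3
    have h3 := vol_ball_ne_top (0 : Ed d) 1
    rw [univ_inter]
    finiteness
  have hmain := contact_measure X (closedBall 0 δ) _ (C := ENNReal.ofReal C4 ^ d) (by finiteness)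
    (fun p0 hp0 => local_contact f hfc hτ hC3 hC4 X hX2 (fun p0 p1 h0 h1 ρ hρ hρ1 hXX =>
      hC11 f u hu hsol p0 p1 (X p0) (X p1) (m p0) (m p1) ρ h0 h1 (hX2 p0 h0) (hX2 p1 h1)
        (hXe p0 h0) (hXe p1 h1) (hXle p0 h0) (hXle p1 h1) hρ hρ1 hXX) p0 (by simpa using hp0))
  have himg : X '' closedBall 0 δ ⊆ {x | u x ≤ M} ∩ ball (0 : Ed d) 2 := by
    rintro _ ⟨p, hp, rfl⟩
    have hp' : ‖p‖ ≤ δ := by simpa using hp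
    exact ⟨hXM p hp', by simpa using hX2 p hp'⟩
  have hb := (measure_mono himg).trans (dens_bound hd f hf τ C3 _ hT)
  obtain ⟨V, hV⟩ : ∃ V, V = (volume ({x | u x ≤ M} ∩ ball (0 : Ed d) 1)).toReal := ⟨_, rfl⟩
  have hVt : volume ({x | u x ≤ M} ∩ ball (0 : Ed d) 1) ≠ ⊤ :=
    ((measure_mono inter_subset_right).trans_lt measure_ball_lt_top).ne
  have hVv : volume ({x | u x ≤ M} ∩ ball (0 : Ed d) 1) = ENNReal.ofReal V := by
    rw [hV, ENNReal.ofReal_toReal hVt]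
  have hV0 : 0 ≤ V := by rw [hV]; exact ENNReal.toReal_nonneg
  have h12 : volume ({x | u x ≤ M} ∩ ball (0 : Ed d) 2 ∩ ball (0 : Ed d) 1) ≤ ENNReal.ofReal V := by
    rw [← hVv]
    refine measure_mono ?_
    rintro y ⟨⟨h1, _⟩, h2⟩
    exact ⟨h1, h2⟩
  have hfinal : ENNReal.ofReal (δ ^ d * w) ≤ ENNReal.ofReal ((3 * C4) ^ d *
      (ε0 ^ d + (2 * τ) ^ d * (3 ^ d * w) + C3 ^ d * V)) := by
    calc ENNReal.ofReal (δ ^ d * w) = volume (closedBall (0 : Ed d) δ) := by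
          rw [vol_closedBall _ hδ.le, hwv, ENNReal.ofReal_mul (by positivity),
            ENNReal.ofReal_pow hδ.le]
      _ ≤ _ := hmain
      _ ≤ ENNReal.ofReal C4 ^ d * (3 ^ d * (ENNReal.ofReal ε0 ^ d
          + ENNReal.ofReal (2 * τ) ^ d * (3 ^ d * ENNReal.ofReal w)
          + ENNReal.ofReal C3 ^ d * ENNReal.ofReal V)) := by
          gcongr
          refine hb.trans ?_
          have h3 : volume (ball (0 : Ed d) 3) = 3 ^ d * ENNReal.ofReal w := by
            rw [vol_ball _ (by norm_num), hwv]; simp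
          rw [h3]
          gcongr
      _ = _ := by
          exact ofReal_combine hC4.le hε0.le (by positivity) hw0.le hC3.le hV0
  rw [ENNReal.ofReal_le_ofReal_iff (by positivity)] at hfinal
  rw [hVv, hwv, ← ENNReal.ofReal_mul (by positivity)]
  apply ENNReal.ofReal_le_ofReal
  have h5 : δ ^ d * w / 2 ≤ (3 * C4) ^ d * C3 ^ d * V := by nlinarith
  calc _ ≤ δ ^ d / (2 * ((3 * C4) ^ d * C3 ^ d)) * w :=
        mul_le_mul_of_nonneg_right (min_le_right _ _) hw0.le
    _ = (δ ^ d * w / 2) / ((3 * C4) ^ d * C3 ^ d) := by field_simp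
    _ ≤ V := by rw [div_le_iff₀ (by positivity)]; linarith


/-! ### The growing ink spots lemma -/

lemma ink_ball {d : ℕ} {E F : Set (Ed d)} (hF : IsOpen F)
    (hF1 : F ⊆ ball 0 1) {μ : ℝ} (hμ1 : μ < 1)
    (hstep : ∀ c t, 0 < t → ‖c‖ + t ≤ 1 →
      ENNReal.ofReal (1 - μ) * volume (ball c t) < volume (E ∩ ball c t) → ball c t ⊆ F)
    (hone : volume (E ∩ ball 0 1) ≤ ENNReal.ofReal (1 - μ) * volume (ball (0 : Ed d) 1))
    {x : Ed d} (hx : x ∈ F) :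
    ∃ c t, 0 < t ∧ t ≤ 1 ∧ x ∈ ball c t ∧ ball c t ⊆ F ∧
      volume (E ∩ ball c t) ≤ ENNReal.ofReal (1 - μ) * volume (ball c t) := by
  have hxn : ‖x‖ < 1 := by simpa using hF1 hx
  let B : ℝ → Set (Ed d) := fun t => ball ((1 - t) • x) t
  have hdist : ∀ t t', t ≤ t' → ‖(1 - t) • x - (1 - t') • x‖ ≤ t' - t := by
    intro t t' h
    rw [← sub_smul, norm_smul]
    have : |1 - t - (1 - t')| = t' - t := by
      rw [abs_of_nonneg (by linarith)]; ring
    rw [Real.norm_eq_abs, this]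
    nlinarith [norm_nonneg x]
  have hmono : ∀ t t', t ≤ t' → B t ⊆ B t' := by
    intro t t' h
    refine ball_subset_ball' ?_
    rw [dist_eq_norm]
    linarith [hdist t t' h]
  have hmem : ∀ t, 0 < t → x ∈ B t := by
    intro t ht
    simp only [B, mem_ball, dist_eq_norm]
    have : x - (1 - t) • x = t • x := by rw [sub_smul, one_smul]; abel
    rw [this, norm_smul, Real.norm_of_nonneg ht.le]
    nlinarith
  have hcn : ∀ t, 0 < t → t ≤ 1 → ‖(1 - t) • x‖ + t ≤ 1 := by
    intro t ht ht1
    rw [norm_smul, Real.norm_of_nonneg (by linarith)]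
    nlinarith
  let S : Set ℝ := {t | 0 < t ∧ t ≤ 1 ∧ B t ⊆ F}
  have hSne : S.Nonempty := by
    obtain ⟨η, hη, hηF⟩ := Metric.isOpen_iff.1 hF x hx
    refine ⟨min 1 (η / 2), by positivity, min_le_left _ _, ?_⟩
    refine Subset.trans (ball_subset_ball' ?_) hηF
    rw [dist_eq_norm]
    have h1 := min_le_right 1 (η / 2)
    have h0 : 0 < min 1 (η / 2) := by positivity
    have : (1 - min 1 (η / 2)) • x - x = -(min 1 (η / 2) • x) := by
      rw [sub_smul, one_smul]; abel
    rw [this, norm_neg, norm_smul, Real.norm_of_nonneg h0.le]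
    nlinarith
  have hSb : BddAbove S := ⟨1, fun t ht => ht.2.1⟩
  obtain ⟨T, hT⟩ : ∃ T, T = sSup S := ⟨_, rfl⟩
  have hT0 : 0 < T := by
    obtain ⟨t, ht⟩ := hSne
    exact ht.1.trans_le (hT ▸ le_csSup hSb ht)
  have hT1 : T ≤ 1 := hT ▸ csSup_le hSne fun t ht => ht.2.1
  have hTF : B T ⊆ F := by
    intro y hy
    simp only [B, mem_ball, dist_eq_norm] at hy
    have hlt : T - (T - ‖y - (1 - T) • x‖) / 3 < sSup S := by rw [← hT]; linarith
    obtain ⟨s, hs, hs1⟩ := exists_lt_of_lt_csSup hSne hlt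
    have hsT : s ≤ T := hT ▸ le_csSup hSb hs
    refine hs.2.2 ?_
    simp only [B, mem_ball, dist_eq_norm]
    have h1 := hdist s T hsT
    have : y - (1 - s) • x = (y - (1 - T) • x) - ((1 - s) • x - (1 - T) • x) := by abel
    rw [this]
    refine (norm_sub_le _ _).trans_lt ?_
    linarith
  refine ⟨(1 - T) • x, T, hT0, hT1, hmem T hT0, hTF, ?_⟩
  rcases hT1.eq_or_lt with h1 | h1
  · rw [h1]; simpa using hone
  have hup : ∀ t, T < t → t ≤ 1 →
      volume (E ∩ ball ((1 - T) • x) T) ≤ ENNReal.ofReal ((1 - μ) * (t ^ d *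
        (volume (ball (0 : Ed d) 1)).toReal)) := by
    intro t ht ht1
    have ht0 : 0 < t := hT0.trans ht
    have hn : ¬ (B t ⊆ F) := by
      intro h
      have := le_csSup hSb (show t ∈ S from ⟨ht0, ht1, h⟩)
      rw [← hT] at this
      linarith
    have h2 : volume (E ∩ B t) ≤ ENNReal.ofReal (1 - μ) * volume (B t) := by
      by_contra hcon
      exact hn (hstep _ t ht0 (hcn t ht0 ht1) (not_le.1 hcon))
    refine (measure_mono (inter_subset_inter_right E (hmono T t ht.le))).trans (h2.trans_eq ?_)
    simp only [B]
    rw [vol_ball _ ht0, ENNReal.ofReal_mul (by linarith), ENNReal.ofReal_mul (by positivity),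
      ENNReal.ofReal_toReal (vol_ball_ne_top _ _), ENNReal.ofReal_pow ht0.le]
  have hlim : Filter.Tendsto (fun t : ℝ => ENNReal.ofReal ((1 - μ) * (t ^ d *
        (volume (ball (0 : Ed d) 1)).toReal))) (nhdsWithin T (Ioi T)) (nhds
        (ENNReal.ofReal ((1 - μ) * (T ^ d * (volume (ball (0 : Ed d) 1)).toReal)))) := by
    have : Continuous (fun t : ℝ => ENNReal.ofReal ((1 - μ) * (t ^ d *
        (volume (ball (0 : Ed d) 1)).toReal))) := ENNReal.continuous_ofReal.comp (by fun_prop)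
    exact (this.tendsto T).mono_left nhdsWithin_le_nhds
  have hev : ∀ᶠ t in nhdsWithin T (Ioi T), volume (E ∩ ball ((1 - T) • x) T) ≤
      ENNReal.ofReal ((1 - μ) * (t ^ d * (volume (ball (0 : Ed d) 1)).toReal)) := by
    filter_upwards [Ioc_mem_nhdsGT h1] with t ht
    exact hup t ht.1 ht.2
  refine (ge_of_tendsto hlim hev).trans_eq ?_
  rw [vol_ball _ hT0, ENNReal.ofReal_mul (by linarith), ENNReal.ofReal_mul (by positivity),
      ENNReal.ofReal_toReal (vol_ball_ne_top _ _), ENNReal.ofReal_pow hT0.le]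

lemma ink_spots {d : ℕ} {E F : Set (Ed d)} (hE : MeasurableSet E) (hEF : E ⊆ F) (hF : IsOpen F)
    (hF1 : F ⊆ ball 0 1) {μ : ℝ} (hμ0 : 0 < μ) (hμ1 : μ < 1)
    (hstep : ∀ c t, 0 < t → ‖c‖ + t ≤ 1 →
      ENNReal.ofReal (1 - μ) * volume (ball c t) < volume (E ∩ ball c t) → ball c t ⊆ F)
    (hone : volume (E ∩ ball 0 1) ≤ ENNReal.ofReal (1 - μ) * volume (ball (0 : Ed d) 1)) :
    volume E ≤ ENNReal.ofReal (1 - μ / 5 ^ d) * volume F := by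
  choose! c t ht0 ht1 hxc hcF hEc using
    fun x (hx : x ∈ F) => ink_ball hF hF1 hμ1 hstep hone hx
  obtain ⟨v, hvF, hdisj, hcov⟩ :=
    Vitali.exists_disjoint_subfamily_covering_enlargement_closedBall F c t 1 ht1 5 (by norm_num)
  have hvdisj : v.PairwiseDisjoint (fun x => ball (c x) (t x)) := fun a ha b hb hab =>
    (hdisj ha hb hab).mono ball_subset_closedBall ball_subset_closedBall
  have hvc : v.Countable := hvdisj.countable_of_isOpen (fun _ _ => isOpen_ball)
    (fun x hx => ⟨x, hxc x (hvF hx)⟩)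
  have hFt : volume F ≠ ⊤ := ((measure_mono hF1).trans_lt measure_ball_lt_top).ne
  have hEt : volume E ≠ ⊤ := ((measure_mono hEF).trans_lt hFt.lt_top).ne
  have h1 : volume F ≤ 5 ^ d * ∑' x : v, volume (ball (c x) (t x)) := by
    have hsub : F ⊆ ⋃ x ∈ v, closedBall (c x) (5 * t x) := by
      intro x hx
      obtain ⟨b, hb, hsb⟩ := hcov x hx
      exact mem_biUnion hb (hsb (ball_subset_closedBall (hxc x hx)))
    calc volume F ≤ _ := measure_mono hsub
      _ ≤ ∑' x : v, volume (closedBall (c x) (5 * t x)) := measure_biUnion_le volume hvc _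
      _ = ∑' x : v, 5 ^ d * volume (ball (c x) (t x)) := by
          congr 1; funext x
          have h0 := ht0 x (hvF x.2)
          rw [vol_closedBall _ (by positivity), vol_ball _ h0, ENNReal.ofReal_mul (by norm_num),
            mul_pow, mul_assoc]
          simp
      _ = _ := ENNReal.tsum_mul_left
  have h2 : ∑' x : v, volume (ball (c x) (t x) \ E) ≤ volume (F \ E) := by
    rw [← measure_biUnion (f := fun x => ball (c x) (t x) \ E) hvc]
    · refine measure_mono (iUnion₂_subset fun x hx => diff_subset_diff_left (hcF x (hvF hx)))
    · exact fun a ha b hb hab => (hvdisj ha hb hab).mono diff_subset diff_subset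
    · exact fun x _ => measurableSet_ball.diff hE
  have h3 : ∀ x : v, ENNReal.ofReal μ * volume (ball (c x) (t x)) ≤
      volume (ball (c x) (t x) \ E) := by
    intro x
    have h4 := hEc x (hvF x.2)
    have h5 : volume (ball (c x) (t x)) =
        volume (ball (c x) (t x) ∩ E) + volume (ball (c x) (t x) \ E) :=
      (measure_inter_add_sdiff _ hE).symm
    have hft := vol_ball_ne_top (c x) (t x)
    have e : volume (ball (c x) (t x)) = ENNReal.ofReal (1 - μ) * volume (ball (c x) (t x))
        + ENNReal.ofReal μ * volume (ball (c x) (t x)) := by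
      rw [← add_mul, ← ENNReal.ofReal_add (by linarith) hμ0.le]; simp
    rw [inter_comm] at h4
    have h6 : ENNReal.ofReal (1 - μ) * volume (ball (c x) (t x))
        + ENNReal.ofReal μ * volume (ball (c x) (t x)) ≤
        ENNReal.ofReal (1 - μ) * volume (ball (c x) (t x)) + volume (ball (c x) (t x) \ E) := by
      rw [← e]
      calc _ = _ := h5
        _ ≤ _ := by gcongr
    exact (ENNReal.add_le_add_iff_left (by finiteness)).1 h6
  have h7 : ENNReal.ofReal (μ / 5 ^ d) * volume F ≤ volume (F \ E) := by
    calc _ ≤ ENNReal.ofReal (μ / 5 ^ d) * (5 ^ d * ∑' x : v, volume (ball (c x) (t x))) := by gcongr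
      _ = ENNReal.ofReal μ * ∑' x : v, volume (ball (c x) (t x)) := by
          rw [← mul_assoc]
          congr 1
          have : (5 : ℝ≥0∞) ^ d = ENNReal.ofReal (5 ^ d) := by
            rw [ENNReal.ofReal_pow (by norm_num)]; simp
          rw [this, ← ENNReal.ofReal_mul (by positivity)]
          congr 1; field_simp
      _ = ∑' x : v, ENNReal.ofReal μ * volume (ball (c x) (t x)) := ENNReal.tsum_mul_left.symm
      _ ≤ _ := (ENNReal.tsum_le_tsum h3).trans h2
  have h8 : volume E + volume (F \ E) = volume F := by
    have := measure_inter_add_sdiff (μ := volume) F hE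
    rwa [inter_eq_right.2 hEF] at this
  have hle : μ / 5 ^ d ≤ 1 := by
    rw [div_le_one (by positivity)]
    have : (1 : ℝ) ≤ 5 ^ d := one_le_pow₀ (by norm_num)
    linarith
  have e : volume F = ENNReal.ofReal (1 - μ / 5 ^ d) * volume F
      + ENNReal.ofReal (μ / 5 ^ d) * volume F := by
    rw [← add_mul, ← ENNReal.ofReal_add (by linarith) (by positivity)]; simp
  have h9 : volume E + ENNReal.ofReal (μ / 5 ^ d) * volume F ≤
      ENNReal.ofReal (1 - μ / 5 ^ d) * volume F + ENNReal.ofReal (μ / 5 ^ d) * volume F := by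
    rw [← e]
    calc _ ≤ volume E + volume (F \ E) := by gcongr
      _ = _ := h8
  exact (ENNReal.add_le_add_iff_right (by finiteness)).1 h9


/-! ### Decay of the distribution function -/

lemma Sol.mono {d : ℕ} {lam Lam κ : ℝ} {f : Ed d → ℝ} {O O' : Set (Ed d)}
    {u : Ed d → ℝ} (h : Sol lam Lam κ f O u) (hO : O' ⊆ O) : Sol lam Lam κ f O' u :=
  fun φ N c x hφ hx => h φ N c x hφ (hO hx)

lemma map_affine {d : ℕ} (c : Ed d) {t : ℝ} (ht : 0 < t) :
    Measure.map (fun y : Ed d => c + t • y) volume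
      = (ENNReal.ofReal t⁻¹ ^ d) • (volume : Measure (Ed d)) := by
  have h1 : (fun y : Ed d => c + t • y) = (fun y => c + y) ∘ (fun y => t • y) := rfl
  rw [h1, ← Measure.map_map (by fun_prop) (by fun_prop), Measure.map_addHaar_smul volume ht.ne',
    Measure.map_smul, map_add_left_eq_self]
  congr 1
  rw [abs_of_pos (by positivity), ← inv_pow, ENNReal.ofReal_pow (by positivity)]
  simp

lemma setLIntegral_affine {d : ℕ} (c : Ed d) {t : ℝ} (ht : 0 < t) {h : Ed d → ℝ≥0∞}
    (hh : Measurable h) {S : Set (Ed d)} (hS : MeasurableSet S) :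
    ∫⁻ y in {y | c + t • y ∈ S}, h (c + t • y) = ENNReal.ofReal t⁻¹ ^ d * ∫⁻ x in S, h x := by
  have h1 := setLIntegral_map (μ := volume) hS hh (g := fun y : Ed d => c + t • y) (by fun_prop)
  rw [map_affine c ht, setLIntegral_smul_measure] at h1
  exact h1.symm

lemma vol_affine {d : ℕ} (c : Ed d) {t : ℝ} (ht : 0 < t) {S : Set (Ed d)} (hS : MeasurableSet S) :
    volume {y | c + t • y ∈ S} = ENNReal.ofReal t⁻¹ ^ d * volume S := by
  have h1 := setLIntegral_affine c ht (h := fun _ => 1) measurable_const hS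
  simpa using h1

lemma preimage_ball {d : ℕ} (c : Ed d) {t R : ℝ} (ht : 0 < t) :
    {y : Ed d | c + t • y ∈ ball c (t * R)} = ball 0 R := by
  ext y
  simp only [mem_ofPred_eq, mem_ball, dist_eq_norm, add_sub_cancel_left, norm_smul, sub_zero,
    Real.norm_of_nonneg ht.le]
  exact mul_lt_mul_iff_right₀ ht

/-- The conclusion of `point_to_measure`. -/
def PTM (d : ℕ) (lam Lam κ M μ ε0 : ℝ) : Prop :=
  ∀ f u : Ed d → ℝ, Measurable f → ContinuousOn f (ball 0 3) →
        (∫⁻ x in ball (0 : Ed d) 3, ENNReal.ofReal |f x| ^ d) ≤ ENNReal.ofReal ε0 ^ d →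
        LowerSemicontinuous u → (∀ y, 0 ≤ u y) → Sol lam Lam κ f (ball 0 3) u →
        ∀ x0, ‖x0‖ ≤ 1 → u x0 ≤ 1 →
        ENNReal.ofReal μ * volume (ball (0 : Ed d) 1) ≤
          volume ({x | u x ≤ M} ∩ ball (0 : Ed d) 1)

lemma lsc_affine {d : ℕ} {u : Ed d → ℝ} (hu : LowerSemicontinuous u) (c : Ed d) (t : ℝ) {m : ℝ}
    (hm : 0 < m) : LowerSemicontinuous (fun y => u (c + t • y) / m) := by
  have h1 : LowerSemicontinuous (fun y => u (c + t • y)) :=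
    hu.comp (g := fun y => c + t • y) (by fun_prop)
  have h2 : Monotone (fun a : ℝ => a / m) := fun a b h => div_le_div_of_nonneg_right h hm.le
  exact Continuous.comp_lowerSemicontinuous (by fun_prop : Continuous fun a : ℝ => a / m) h1 h2

set_option maxHeartbeats 1000000 in
lemma decay_step {d : ℕ} {lam Lam κ M μ ε0 : ℝ} (hP : PTM d lam Lam κ M μ ε0)
    (hM : 1 < M) (hμ0 : 0 < μ) (hμ1 : μ < 1)
    {f u : Ed d → ℝ} (hf : Measurable f) (hfc : ContinuousOn f (ball 0 3))
    (hfi : (∫⁻ x in ball (0 : Ed d) 3, ENNReal.ofReal |f x| ^ d) ≤ ENNReal.ofReal ε0 ^ d)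
    (hu : LowerSemicontinuous u) (hu0 : ∀ y, 0 ≤ u y) (hsol : Sol lam Lam κ f (ball 0 3) u)
    {c : Ed d} {t : ℝ} (ht : 0 < t) (hct : ‖c‖ + t ≤ 1) (k : ℕ) {x : Ed d} (hx : x ∈ ball c t)
    (hux : u x ≤ M ^ k) :
    volume ({y | M ^ (k + 1) < u y} ∩ ball c t) ≤ ENNReal.ofReal (1 - μ) * volume (ball c t) := by
  have hm : 0 < M ^ k := by positivity
  have hm1 : 1 ≤ M ^ k := one_le_pow₀ hM.le
  have ht1 : t ≤ 1 := by linarith [norm_nonneg c]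
  have hsub : ball c (t * 3) ⊆ ball 0 3 := by
    refine ball_subset_ball' ?_
    rw [dist_zero_right]; linarith
  have hpre : ball (0 : Ed d) 3 ⊆ {y | c + t • y ∈ ball (0 : Ed d) 3} := by
    intro y hy
    rw [← preimage_ball c ht] at hy
    exact hsub hy
  have hgm : Measurable (fun y => t ^ 2 / M ^ k * f (c + t • y)) :=
    (hf.comp (by fun_prop : Measurable fun y : Ed d => c + t • y)).const_mul _
  have hgc : ContinuousOn (fun y => t ^ 2 / M ^ k * f (c + t • y)) (ball 0 3) := by
    refine continuousOn_const.mul ?_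
    exact hfc.comp (Continuous.continuousOn (by fun_prop)) hpre
  have hgi : (∫⁻ y in ball (0 : Ed d) 3, ENNReal.ofReal |t ^ 2 / M ^ k * f (c + t • y)| ^ d)
      ≤ ENNReal.ofReal ε0 ^ d := by
    have e : ∀ y, ENNReal.ofReal |t ^ 2 / M ^ k * f (c + t • y)| ^ d
        = ENNReal.ofReal (t ^ 2 / M ^ k) ^ d * ENNReal.ofReal |f (c + t • y)| ^ d := by
      intro y
      rw [abs_mul, abs_of_pos (by positivity), ENNReal.ofReal_mul (by positivity), mul_pow]
    simp only [e]
    rw [lintegral_const_mul' _ _ (by finiteness), ← preimage_ball c ht,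
      setLIntegral_affine c ht (h := fun x => ENNReal.ofReal |f x| ^ d) (by fun_prop)
      measurableSet_ball, ← mul_assoc, ← mul_pow, ← ENNReal.ofReal_mul (by positivity)]
    have e2 : t ^ 2 / M ^ k * t⁻¹ ≤ 1 := by
      have : t ^ 2 / M ^ k * t⁻¹ = t / M ^ k := by field_simp
      rw [this, div_le_one hm]; linarith
    have e3 : ENNReal.ofReal (t ^ 2 / M ^ k * t⁻¹) ^ d ≤ 1 := by
      refine pow_le_one' ?_ d
      simpa using ENNReal.ofReal_le_ofReal e2
    calc _ ≤ 1 * ∫⁻ x in ball c (t * 3), ENNReal.ofReal |f x| ^ d := mul_le_mul_left e3 _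
      _ ≤ ∫⁻ x in ball (0 : Ed d) 3, ENNReal.ofReal |f x| ^ d := by
        rw [one_mul]; exact lintegral_mono_set hsub
      _ ≤ _ := hfi
  have hxn : ‖t⁻¹ • (x - c)‖ ≤ 1 := by
    rw [mem_ball, dist_eq_norm] at hx
    rw [norm_smul, Real.norm_of_nonneg (by positivity), inv_mul_le_iff₀ ht]
    linarith
  have hux' : u (c + t • (t⁻¹ • (x - c))) / M ^ k ≤ 1 := by
    rw [smul_smul, mul_inv_cancel₀ ht.ne', one_smul, add_sub_cancel]
    rwa [div_le_one hm]
  have hu0' : ∀ y, 0 ≤ u (c + t • y) / M ^ k := fun y => div_nonneg (hu0 _) hm.le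
  have h1 := hP _ _ hgm hgc hgi (lsc_affine hu c t hm) hu0'
    ((hsol.scale c ht ht1 hm).mono hpre) _ hxn hux'
  have hle : MeasurableSet ({x | u x ≤ M ^ (k + 1)} ∩ ball c t) :=
    (lsc_measurableSet_le hu _).inter measurableSet_ball
  have hgt : {y | M ^ (k + 1) < u y} ∩ ball c t = ball c t \ {x | u x ≤ M ^ (k + 1)} := by
    ext y; simp [and_comm]
  have e1 : {x | u (c + t • x) / M ^ k ≤ M} ∩ ball (0 : Ed d) 1
      = {y | c + t • y ∈ {x | u x ≤ M ^ (k + 1)} ∩ ball c t} := by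
    have : ball (0 : Ed d) 1 = {y | c + t • y ∈ ball c t} := by
      rw [← preimage_ball c ht, mul_one]
    rw [this]
    ext y
    simp only [mem_inter_iff, mem_ofPred_eq]
    rw [div_le_iff₀ hm, pow_succ, mul_comm M]
  rw [e1, vol_affine c ht hle] at h1
  have hv : volume (ball c t) = ENNReal.ofReal t ^ d * volume (ball (0 : Ed d) 1) := vol_ball c ht
  have h2 : ENNReal.ofReal μ * volume (ball c t) ≤
      volume ({x | u x ≤ M ^ (k + 1)} ∩ ball c t) := by
    have hcancel : ENNReal.ofReal t ^ d * ENNReal.ofReal t⁻¹ ^ d = 1 := by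
      rw [← mul_pow, ← ENNReal.ofReal_mul ht.le, mul_inv_cancel₀ ht.ne']; simp
    calc _ = ENNReal.ofReal t ^ d * (ENNReal.ofReal μ * volume (ball (0 : Ed d) 1)) := by
          rw [hv]; ring
      _ ≤ ENNReal.ofReal t ^ d * (ENNReal.ofReal t⁻¹ ^ d *
          volume ({x | u x ≤ M ^ (k + 1)} ∩ ball c t)) := by gcongr
      _ = _ := by rw [← mul_assoc, hcancel, one_mul]
  have h3 := measure_inter_add_sdiff (μ := volume) (ball c t) (lsc_measurableSet_le hu (M ^ (k + 1)))
  rw [inter_comm] at h3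
  rw [hgt]
  have hft := vol_ball_ne_top c t
  have e : volume (ball c t) = ENNReal.ofReal μ * volume (ball c t)
        + ENNReal.ofReal (1 - μ) * volume (ball c t) := by
    rw [← add_mul, ← ENNReal.ofReal_add hμ0.le (by linarith)]; simp
  have h6 : ENNReal.ofReal μ * volume (ball c t) + volume (ball c t \ {x | u x ≤ M ^ (k + 1)}) ≤
      ENNReal.ofReal μ * volume (ball c t) + ENNReal.ofReal (1 - μ) * volume (ball c t) := by
    rw [← e]
    calc _ ≤ _ := add_le_add_left h2 _
      _ = _ := h3
  exact (ENNReal.add_le_add_iff_left (by finiteness)).1 h6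

lemma decay {d : ℕ} {lam Lam κ M μ ε0 : ℝ} (hP : PTM d lam Lam κ M μ ε0)
    (hM : 1 < M) (hμ0 : 0 < μ) (hμ1 : μ < 1)
    {f u : Ed d → ℝ} (hf : Measurable f) (hfc : ContinuousOn f (ball 0 3))
    (hfi : (∫⁻ x in ball (0 : Ed d) 3, ENNReal.ofReal |f x| ^ d) ≤ ENNReal.ofReal ε0 ^ d)
    (hu : LowerSemicontinuous u) (hu0 : ∀ y, 0 ≤ u y) (hsol : Sol lam Lam κ f (ball 0 3) u)
    {x0 : Ed d} (hx0 : x0 ∈ ball 0 1) (hux0 : u x0 ≤ 1) (k : ℕ) :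
    volume ({y | M ^ k < u y} ∩ ball (0 : Ed d) 1) ≤
      ENNReal.ofReal (1 - μ / 5 ^ d) ^ k * volume (ball (0 : Ed d) 1) := by
  induction k with
  | zero => simpa using measure_mono inter_subset_right
  | succ k ih =>
    have hstep := fun (c : Ed d) (t : ℝ) (ht : 0 < t) (hct : ‖c‖ + t ≤ 1) (x : Ed d)
      (hx : x ∈ ball c t) (hux : u x ≤ M ^ k) =>
      decay_step hP hM hμ0 hμ1 hf hfc hfi hu hu0 hsol ht hct k hx hux
    have h1 := ink_spots (E := {y | M ^ (k + 1) < u y} ∩ ball (0 : Ed d) 1)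
      (F := {y | M ^ k < u y} ∩ ball (0 : Ed d) 1)
      ((hu.isOpen_preimage _).measurableSet.inter measurableSet_ball)
      (inter_subset_inter_left _ fun y (hy : M ^ (k + 1) < u y) =>
        (pow_le_pow_right₀ hM.le (Nat.le_succ k)).trans_lt hy)
      ((hu.isOpen_preimage _).inter isOpen_ball) inter_subset_right hμ0 hμ1
      (fun c t ht hct hlt x hx => by
        by_contra hcon
        have hxB : x ∈ ball (0 : Ed d) 1 := by
          refine ball_subset_ball' ?_ hx
          rw [dist_zero_right]; linarith
        have hux : u x ≤ M ^ k := by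
          by_contra h
          exact hcon ⟨not_le.1 h, hxB⟩
        have h2 := hstep c t ht hct x hx hux
        refine absurd (hlt.trans_le ((measure_mono ?_).trans h2)) (lt_irrefl _)
        rintro y ⟨⟨h3, _⟩, h4⟩
        exact ⟨h3, h4⟩)
      (hone := by
        have h2 := hstep 0 1 one_pos (by simp) x0 hx0 (hux0.trans (one_le_pow₀ hM.le))
        refine (measure_mono ?_).trans h2
        exact inter_subset_left)
    refine h1.trans ?_
    rw [pow_succ', mul_assoc]
    gcongr


/-! ### The `L^ε` estimate -/

lemma layer_bound {M ε : ℝ} (hM : 1 < M) (hε : 0 < ε) {a : ℝ} (ha : 0 ≤ a) :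
    ENNReal.ofReal (a ^ ε) ≤ 1 + ∑' k : ℕ, ENNReal.ofReal (M ^ ε) ^ (k + 1) *
      {k : ℕ | M ^ k < a}.indicator 1 k := by
  classical
  have hex : ∃ k : ℕ, a ≤ M ^ k := by
    obtain ⟨n, hn⟩ := pow_unbounded_of_one_lt a hM
    exact ⟨n, hn.le⟩
  have hspec := Nat.find_spec hex
  rcases hk : Nat.find hex with _ | k
  · rw [hk, pow_zero] at hspec
    refine le_trans ?_ le_self_add
    simpa using ENNReal.ofReal_le_ofReal (Real.rpow_le_one ha hspec hε.le)
  · have hlt : M ^ k < a := by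
      have := Nat.find_min hex (m := k) (by omega)
      exact not_le.1 this
    rw [hk] at hspec
    refine le_trans ?_ le_add_self
    refine le_trans ?_ (ENNReal.le_tsum k)
    rw [indicator_of_mem (by exact hlt), Pi.one_apply, mul_one, ← ENNReal.ofReal_pow (by positivity)]
    apply ENNReal.ofReal_le_ofReal
    calc a ^ ε ≤ (M ^ (k + 1)) ^ ε := Real.rpow_le_rpow ha hspec hε.le
      _ = (M ^ ε) ^ (k + 1) := by
        rw [← Real.rpow_natCast, ← Real.rpow_natCast, ← Real.rpow_mul (by linarith),
          ← Real.rpow_mul (by linarith), mul_comm]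

lemma exists_eps {M q : ℝ} (hM : 1 < M) (hq1 : q < 1) :
    ∃ ε : ℝ, 0 < ε ∧ ε ≤ 1 ∧ M ^ ε * q < 1 := by
  have hc : Filter.Tendsto (fun ε : ℝ => M ^ ε * q) (nhdsWithin 0 (Ioi 0)) (nhds (M ^ (0 : ℝ) * q)) :=
    (((Real.continuous_const_rpow (by linarith)).mul continuous_const).tendsto 0).mono_left
      nhdsWithin_le_nhds
  rw [Real.rpow_zero, one_mul] at hc
  have h1 := hc.eventually (gt_mem_nhds hq1)
  have h2 : Ioc (0 : ℝ) 1 ∈ nhdsWithin (0 : ℝ) (Ioi 0) := Ioc_mem_nhdsGT one_pos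
  obtain ⟨ε, h3, h4⟩ := (h1.and h2).exists
  exact ⟨ε, h4.1, h4.2, h3⟩

lemma core_normalized {d : ℕ} (hd : 1 ≤ d) {lam Lam : ℝ} (hlam : 0 < lam) (hLam : lam ≤ Lam) :
    ∃ κ ε C ε0 : ℝ, 0 < κ ∧ 0 < ε ∧ ε ≤ 1 ∧ 0 < C ∧ 0 < ε0 ∧
      ∀ f u : Ed d → ℝ, Measurable f → ContinuousOn f (ball 0 3) →
        (∫⁻ x in ball (0 : Ed d) 3, ENNReal.ofReal |f x| ^ d) ≤ ENNReal.ofReal ε0 ^ d →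
        LowerSemicontinuous u → (∀ y, 0 ≤ u y) → Sol lam Lam κ f (ball 0 3) u →
        ∀ x0 ∈ ball (0 : Ed d) 1, u x0 ≤ 1 →
        ∫⁻ x in ball (0 : Ed d) 1, ENNReal.ofReal (u x ^ ε) ≤ ENNReal.ofReal C := by
  obtain ⟨κ, M, μ, ε0, hκ, hM, hμ0, hμ1, hε0, hP⟩ := point_to_measure hd hlam hLam
  obtain ⟨q, hq⟩ : ∃ q, q = 1 - μ / 5 ^ d := ⟨_, rfl⟩
  have hμ5 : μ / 5 ^ d < 1 := by
    rw [div_lt_one (by positivity)]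
    have : (1 : ℝ) ≤ 5 ^ d := one_le_pow₀ (by norm_num)
    linarith
  have hμ5' : 0 < μ / 5 ^ d := by positivity
  have hq0 : 0 < q := by rw [hq]; linarith
  have hq1 : q < 1 := by rw [hq]; linarith
  obtain ⟨ε, hε, hε1, hεq⟩ := exists_eps hM hq1
  have hMε : 0 < M ^ ε := by positivity
  obtain ⟨Z, hZ⟩ : ∃ Z : ℝ≥0∞, Z = volume (ball (0 : Ed d) 1) + ∑' k : ℕ,
      ENNReal.ofReal (M ^ ε) ^ (k + 1) * (ENNReal.ofReal q ^ k * volume (ball (0 : Ed d) 1)) :=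
    ⟨_, rfl⟩
  have hZt : Z ≠ ⊤ := by
    have e : ∀ k : ℕ, ENNReal.ofReal (M ^ ε) ^ (k + 1) *
        (ENNReal.ofReal q ^ k * volume (ball (0 : Ed d) 1))
        = (ENNReal.ofReal (M ^ ε) * volume (ball (0 : Ed d) 1)) * ENNReal.ofReal (M ^ ε * q) ^ k := by
      intro k
      rw [ENNReal.ofReal_mul hMε.le, mul_pow]; ring
    rw [hZ]
    simp only [e]
    rw [ENNReal.tsum_mul_left, ENNReal.tsum_geometric]
    have h1 := vol_ball_ne_top (0 : Ed d) 1
    have h2 : (1 - ENNReal.ofReal (M ^ ε * q))⁻¹ ≠ ⊤ := by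
      rw [ENNReal.inv_ne_top]
      refine (tsub_pos_of_lt ?_).ne'
      rw [← ENNReal.ofReal_one]
      exact (ENNReal.ofReal_lt_ofReal_iff one_pos).2 hεq
    finiteness
  refine ⟨κ, ε, Z.toReal + 1, ε0, hκ, hε, hε1, by positivity, hε0, ?_⟩
  intro f u hf hfc hfi hu hu0 hsol x0 hx0 hux0
  have hdec := decay hP hM hμ0 hμ1 hf hfc hfi hu hu0 hsol hx0 hux0
  rw [← hq] at hdec
  have hZle : Z ≤ ENNReal.ofReal (Z.toReal + 1) := by
    rw [← ENNReal.ofReal_toReal hZt]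
    apply ENNReal.ofReal_le_ofReal
    rw [ENNReal.ofReal_toReal hZt]; linarith
  refine le_trans ?_ hZle
  have hind : ∀ (k : ℕ) (x : Ed d), {k : ℕ | M ^ k < u x}.indicator (1 : ℕ → ℝ≥0∞) k
      = {y | M ^ k < u y}.indicator (fun _ => 1) x := by
    intro k x
    by_cases h : M ^ k < u x
    · rw [indicator_of_mem (by exact h), indicator_of_mem (by exact h)]; rfl
    · rw [indicator_of_notMem (by exact h), indicator_of_notMem (by exact h)]
  have hms : ∀ k : ℕ, MeasurableSet {y | M ^ k < u y} := fun k =>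
    (hu.isOpen_preimage _).measurableSet
  calc _ ≤ ∫⁻ x in ball (0 : Ed d) 1, (1 + ∑' k : ℕ, ENNReal.ofReal (M ^ ε) ^ (k + 1) *
          {y | M ^ k < u y}.indicator (fun _ => 1) x) := by
        refine lintegral_mono fun x => ?_
        have := layer_bound hM hε (hu0 x)
        simp only [hind] at this
        exact this
    _ = volume (ball (0 : Ed d) 1) + ∑' k : ℕ, ENNReal.ofReal (M ^ ε) ^ (k + 1) *
          volume ({y | M ^ k < u y} ∩ ball (0 : Ed d) 1) := by
        rw [lintegral_add_left measurable_const, lintegral_tsum]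
        · congr 1
          · simp
          · congr 1; funext k
            rw [lintegral_const_mul' _ _ (by finiteness), lintegral_indicator (hms k)]
            simp [Measure.restrict_apply (hms k)]
        · intro k
          exact ((measurable_const.indicator (hms k)).const_mul _).aemeasurable
    _ ≤ Z := by
        rw [hZ]
        gcongr with k
        exact hdec k

lemma core_est {d : ℕ} (hd : 1 ≤ d) {lam Lam : ℝ} (hlam : 0 < lam) (hLam : lam ≤ Lam) :
    ∃ κ ε C : ℝ, 0 < κ ∧ 0 < ε ∧ ε ≤ 1 ∧ 0 < C ∧
      ∀ (f u : Ed d → ℝ) (F : ℝ), 0 < F → Measurable f → ContinuousOn f (ball 0 3) →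
        (∫⁻ x in ball (0 : Ed d) 3, ENNReal.ofReal |f x| ^ d) ≤ ENNReal.ofReal F ^ d →
        LowerSemicontinuous u → (∀ y, 0 ≤ u y) → Sol lam Lam κ f (ball 0 3) u →
        ∀ x0 ∈ ball (0 : Ed d) 1,
        ∫⁻ x in ball (0 : Ed d) 1, ENNReal.ofReal (u x ^ ε) ≤
          ENNReal.ofReal (C * (u x0 + F) ^ ε) := by
  obtain ⟨κ, ε, C, ε0, hκ, hε, hε1, hC, hε0, h⟩ := core_normalized hd hlam hLam
  refine ⟨κ, ε, C * (1 + ε0⁻¹) ^ ε, hκ, hε, hε1, by positivity, ?_⟩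
  intro f u F hF hf hfc hfi hu hu0 hsol x0 hx0
  obtain ⟨m, hm⟩ : ∃ m, m = u x0 + ε0⁻¹ * F := ⟨_, rfl⟩
  have hm0 : 0 < m := by rw [hm]; have := hu0 x0; positivity
  have hFm : F / m ≤ ε0 := by
    rw [div_le_iff₀ hm0, hm, mul_add, ← mul_assoc, mul_inv_cancel₀ hε0.ne']
    nlinarith [mul_nonneg hε0.le (hu0 x0)]
  have hsc := hsol.scale 0 one_pos le_rfl hm0
  simp only [zero_add, one_smul, one_pow] at hsc
  have hlsc := lsc_affine hu 0 1 hm0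
  simp only [zero_add, one_smul] at hlsc
  have h1 := h (fun y => 1 / m * f y) (fun y => u y / m) (hf.const_mul _)
    (continuousOn_const.mul hfc) (by
      have e : ∀ y, ENNReal.ofReal |1 / m * f y| ^ d
          = ENNReal.ofReal (1 / m) ^ d * ENNReal.ofReal |f y| ^ d := by
        intro y
        rw [abs_mul, abs_of_pos (by positivity), ENNReal.ofReal_mul (by positivity), mul_pow]
      simp only [e]
      rw [lintegral_const_mul' _ _ (by finiteness)]
      calc _ ≤ ENNReal.ofReal (1 / m) ^ d * ENNReal.ofReal F ^ d := by gcongr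
        _ = ENNReal.ofReal (F / m) ^ d := by
          rw [← mul_pow, ← ENNReal.ofReal_mul (by positivity)]; congr 2; ring
        _ ≤ _ := by gcongr)
    hlsc (fun y => div_nonneg (hu0 y) hm0.le) (hsc.mono fun y hy => hy) x0 hx0 (by
      rw [div_le_one hm0, hm]
      have : 0 ≤ ε0⁻¹ * F := by positivity
      linarith)
  have e2 : ∀ x, ENNReal.ofReal (u x ^ ε) =
      ENNReal.ofReal (m ^ ε) * ENNReal.ofReal ((u x / m) ^ ε) := by
    intro x
    rw [← ENNReal.ofReal_mul (by positivity), ← Real.mul_rpow hm0.le (div_nonneg (hu0 x) hm0.le),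
      mul_div_cancel₀ _ hm0.ne']
  simp only [e2]
  rw [lintegral_const_mul' _ _ (by finiteness)]
  calc _ ≤ ENNReal.ofReal (m ^ ε) * ENNReal.ofReal C := by gcongr
    _ = ENNReal.ofReal (m ^ ε * C) := (ENNReal.ofReal_mul (by positivity)).symm
    _ ≤ _ := by
      apply ENNReal.ofReal_le_ofReal
      have hx := hu0 x0
      have h2 : m ≤ (1 + ε0⁻¹) * (u x0 + F) := by
        rw [hm]
        have : 0 < ε0⁻¹ := by positivity
        nlinarith [mul_nonneg this.le hx]
      calc m ^ ε * C ≤ ((1 + ε0⁻¹) * (u x0 + F)) ^ ε * C := by gcongr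
        _ = _ := by rw [Real.mul_rpow (by positivity) (by positivity)]; ring


/-! ### Local estimate on small balls, chaining and covering -/

lemma local_est {d : ℕ} (hd : 1 ≤ d) {lam Lam C0 : ℝ} (hlam : 0 < lam) (hLam : lam ≤ Lam)
    (hC0 : 0 ≤ C0) {K : Ed d → ℝ} (hK : KernCond K) :
    ∃ ε C s0 : ℝ, 0 < ε ∧ ε ≤ 1 ∧ 0 < C ∧ 0 < s0 ∧ s0 ≤ 1 ∧
      ∀ r, 0 < r → r ≤ 1 → ∀ s, 0 < s → s ≤ s0 → ∀ (z : Ed d) (O : Set (Ed d)), MeasurableSet O →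
      ball z (s * 3) ⊆ O → ∀ f : Ed d → ℝ, ContinuousOn f O → ∀ u : Ed d → ℝ,
      LowerSemicontinuous u → (∀ y, 0 ≤ u y) → SupersolExtremal lam Lam C0 r K f O u →
      ∀ F, 0 < F →
      ENNReal.ofReal s ^ d * (∫⁻ x in O, ENNReal.ofReal |f x| ^ d) ≤ ENNReal.ofReal F ^ d →
      ∀ x0 ∈ ball z s, ∫⁻ x in ball z s, ENNReal.ofReal (u x ^ ε) ≤
        ENNReal.ofReal s ^ d * ENNReal.ofReal (C * (u x0 + F) ^ ε) := by
  classical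
  obtain ⟨κ, ε, C, hκ, hε, hε1, hC, hcore⟩ := core_est hd hlam hLam
  obtain ⟨s0, hs0, hs01, hsol⟩ := init_sol (d := d) (K := K) hLam hC0 hK hκ
  refine ⟨ε, C, s0, hε, hε1, hC, hs0, hs01, ?_⟩
  intro r hr hr1 s hs hss z O hO hzO f hf u hu hu0 hsup F hF hfF x0 hx0
  set g : Ed d → ℝ := O.piecewise f (fun _ => 0) with hg
  have hgO : ∀ x ∈ O, g x = f x := fun x hx => by simp [hg, hx]
  have hgm : Measurable g := ContinuousOn.measurable_piecewise hf continuousOn_const hO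
  have hgc : ContinuousOn g O := hf.congr hgO
  have hsup' : SupersolExtremal lam Lam C0 r K g O u := by
    intro φ h1 h2 x hx h3 h4
    rw [hgO x hx]
    exact hsup φ h1 h2 x hx h3 h4
  have hpre : {y : Ed d | z + s • y ∈ ball z (s * 3)} = ball 0 3 := preimage_ball z hs
  have hpre1 : {y : Ed d | z + s • y ∈ ball z (s * 1)} = ball 0 1 := preimage_ball z hs
  rw [mul_one] at hpre1
  have hsub : ball (0 : Ed d) 3 ⊆ {y | z + s • y ∈ O} := by
    rw [← hpre]; intro y hy; exact hzO hy
  have hS := (hsol r hr hr1 s hs hss z g O u hsup').mono hsub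
  have haff : Continuous (fun y : Ed d => z + s • y) := by fun_prop
  have hF' : (∫⁻ y in ball (0 : Ed d) 3, ENNReal.ofReal |s ^ 2 * g (z + s • y)| ^ d) ≤
      ENNReal.ofReal F ^ d := by
    have h1 : ∀ y : Ed d, ENNReal.ofReal |s ^ 2 * g (z + s • y)| ^ d =
        (ENNReal.ofReal s ^ d * ENNReal.ofReal s ^ d) * (ENNReal.ofReal |g (z + s • y)| ^ d) := by
      intro y
      rw [abs_mul, abs_of_nonneg (by positivity : (0:ℝ) ≤ s ^ 2), ENNReal.ofReal_mul (by positivity),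
        ENNReal.ofReal_pow hs.le, mul_pow]
      ring
    simp_rw [h1]
    have hm : Measurable (fun x : Ed d => ENNReal.ofReal |g x| ^ d) := by fun_prop
    rw [lintegral_const_mul _ (show Measurable (fun y : Ed d => ENNReal.ofReal |g (z + s • y)| ^ d)
        from hm.comp haff.measurable), ← hpre,
      setLIntegral_affine z hs hm measurableSet_ball]
    refine le_trans ?_ hfF
    have h2 : ENNReal.ofReal s ^ d * ENNReal.ofReal s⁻¹ ^ d = 1 := by
      rw [← mul_pow, ← ENNReal.ofReal_mul hs.le, mul_inv_cancel₀ hs.ne']; simp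
    calc ENNReal.ofReal s ^ d * ENNReal.ofReal s ^ d *
          (ENNReal.ofReal s⁻¹ ^ d * ∫⁻ x in ball z (s * 3), ENNReal.ofReal |g x| ^ d)
        = (ENNReal.ofReal s ^ d * ENNReal.ofReal s⁻¹ ^ d) *
          (ENNReal.ofReal s ^ d * ∫⁻ x in ball z (s * 3), ENNReal.ofReal |g x| ^ d) := by ring
      _ = ENNReal.ofReal s ^ d * ∫⁻ x in ball z (s * 3), ENNReal.ofReal |g x| ^ d := by
          rw [h2, one_mul]
      _ ≤ ENNReal.ofReal s ^ d * ∫⁻ x in O, ENNReal.ofReal |g x| ^ d :=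
          mul_le_mul_right (lintegral_mono_set hzO) _
      _ = ENNReal.ofReal s ^ d * ∫⁻ x in O, ENNReal.ofReal |f x| ^ d := by
          congr 1
          exact setLIntegral_congr_fun hO (fun x hx => by simp only [hgO x hx])
  have hul : LowerSemicontinuous (fun y : Ed d => u (z + s • y)) := by
    simpa using lsc_affine hu z s one_pos
  have hx0' : s⁻¹ • (x0 - z) ∈ ball (0 : Ed d) 1 := by
    rw [← hpre1]
    show z + s • s⁻¹ • (x0 - z) ∈ ball z s
    rw [smul_smul, mul_inv_cancel₀ hs.ne', one_smul, add_sub_cancel]; exact hx0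
  have key := hcore (fun y => s ^ 2 * g (z + s • y)) (fun y => u (z + s • y)) F hF
    ((hgm.comp haff.measurable).const_mul _)
    (continuousOn_const.mul (hgc.comp haff.continuousOn hsub)) hF' hul (fun y => hu0 _) hS _ hx0'
  rw [smul_smul, mul_inv_cancel₀ hs.ne', one_smul, add_sub_cancel, ← hpre1,
    setLIntegral_affine z hs (h := fun x => ENNReal.ofReal (u x ^ ε))
      (ENNReal.measurable_ofReal.comp (hu.measurable.pow_const ε)) measurableSet_ball] at key
  have h2 : ENNReal.ofReal s ^ d * ENNReal.ofReal s⁻¹ ^ d = 1 := by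
    rw [← mul_pow, ← ENNReal.ofReal_mul hs.le, mul_inv_cancel₀ hs.ne']; simp
  calc _ = ENNReal.ofReal s ^ d * (ENNReal.ofReal s⁻¹ ^ d *
        ∫⁻ x in ball z s, ENNReal.ofReal (u x ^ ε)) := by rw [← mul_assoc, h2, one_mul]
    _ ≤ _ := mul_le_mul_right key _

/-- One step of the chain. -/
lemma chain_step {d : ℕ} {ε C s F : ℝ} (hε : 0 < ε) (hε1 : ε ≤ 1) (hC : 0 < C) (hs : 0 < s)
    (hF : 0 < F) {u : Ed d → ℝ} (hum : Measurable u) (hu0 : ∀ y, 0 ≤ u y) {z z' : Ed d}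
    (H : ∀ x0 ∈ ball z' s, ∫⁻ x in ball z' s, ENNReal.ofReal (u x ^ ε) ≤
        ENNReal.ofReal s ^ d * ENNReal.ofReal (C * (u x0 + F) ^ ε))
    (hzz : dist z z' < s / 2) :
    (∫⁻ x in ball z' s, ENNReal.ofReal (u x ^ ε)) + ENNReal.ofReal s ^ d * ENNReal.ofReal (F ^ ε) ≤
      (ENNReal.ofReal C * (ENNReal.ofReal (1 / 2) ^ d * volume (ball (0 : Ed d) 1))⁻¹
        + ENNReal.ofReal C + 1) *
      ((∫⁻ x in ball z s, ENNReal.ofReal (u x ^ ε)) +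
        ENNReal.ofReal s ^ d * ENNReal.ofReal (F ^ ε)) := by
  set J := ∫⁻ x in ball z s, ENNReal.ofReal (u x ^ ε)
  set J' := ∫⁻ x in ball z' s, ENNReal.ofReal (u x ^ ε)
  set S := ENNReal.ofReal s ^ d with hS
  set v := ENNReal.ofReal (1 / 2) ^ d * volume (ball (0 : Ed d) 1) with hv
  set c := ENNReal.ofReal C
  set A := ENNReal.ofReal (F ^ ε)
  have hS0 : S ≠ 0 := by simp [hS, hs]
  have hSt : S ≠ ⊤ := by simp [hS]
  have hv0 : v ≠ 0 := by
    rw [hv]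
    refine mul_ne_zero (pow_ne_zero _ (by simp)) (measure_ball_pos _ _ one_pos).ne'
  have hvt : v ≠ ⊤ := ENNReal.mul_ne_top (by simp) (vol_ball_ne_top _ _)
  have hvol : volume (ball z (s / 2)) = S * v := by
    rw [vol_ball z (by positivity), hv, hS, div_eq_mul_one_div, ENNReal.ofReal_mul hs.le, mul_pow,
      mul_assoc]
  have hpt : ∀ y ∈ ball z (s / 2), J' ≤ S * c * (ENNReal.ofReal (u y ^ ε) + A) := by
    intro y hy
    have hy' : y ∈ ball z' s := by
      rw [mem_ball] at hy ⊢
      have := dist_triangle y z z'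
      linarith
    refine (H y hy').trans ?_
    rw [mul_assoc, ENNReal.ofReal_mul hC.le]
    refine mul_le_mul_right (mul_le_mul_right ?_ _) _
    rw [← ENNReal.ofReal_add (Real.rpow_nonneg (hu0 y) _) (Real.rpow_nonneg hF.le _)]
    exact ENNReal.ofReal_le_ofReal (Real.rpow_add_le_add_rpow (hu0 y) hF.le hε.le hε1)
  have hint : J' * (S * v) ≤ S * c * (J + A * (S * v)) := by
    have h1 : ∫⁻ _ in ball z (s / 2), J' ≤
        ∫⁻ y in ball z (s / 2), S * c * (ENNReal.ofReal (u y ^ ε) + A) :=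
      setLIntegral_mono' measurableSet_ball hpt
    have hmm : Measurable (fun y => ENNReal.ofReal (u y ^ ε)) :=
      ENNReal.measurable_ofReal.comp (hum.pow_const ε)
    rw [setLIntegral_const, hvol, lintegral_const_mul _ (hmm.add_const _),
      lintegral_add_left hmm, setLIntegral_const, hvol] at h1
    refine h1.trans (mul_le_mul_right (add_le_add ?_ le_rfl) _)
    exact lintegral_mono_set (ball_subset_ball (by linarith))
  have hJ' : J' ≤ c * v⁻¹ * J + c * (S * A) := by
    have hSv0 : S * v ≠ 0 := mul_ne_zero hS0 hv0
    have hSvt : S * v ≠ ⊤ := ENNReal.mul_ne_top hSt hvt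
    have e1 : J' ≤ (S * c * (J + A * (S * v))) / (S * v) :=
      (ENNReal.le_div_iff_mul_le (Or.inl hSv0) (Or.inl hSvt)).2 hint
    refine e1.trans (le_of_eq ?_)
    have hSS : S * S⁻¹ = 1 := ENNReal.mul_inv_cancel hS0 hSt
    have hvv : v * v⁻¹ = 1 := ENNReal.mul_inv_cancel hv0 hvt
    rw [div_eq_mul_inv, ENNReal.mul_inv (Or.inl hS0) (Or.inl hSt)]
    calc S * c * (J + A * (S * v)) * (S⁻¹ * v⁻¹)
        = (S * S⁻¹) * (c * v⁻¹ * J) + (S * S⁻¹) * (v * v⁻¹) * (c * (S * A)) := by ring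
      _ = _ := by rw [hSS, hvv, one_mul, one_mul, one_mul]
  calc J' + S * A ≤ (c * v⁻¹ * J + c * (S * A)) + S * A := add_le_add hJ' le_rfl
    _ ≤ (c * v⁻¹ * J + c * (S * A)) + S * A + (c * J + J + c * v⁻¹ * (S * A)) := le_self_add
    _ = (c * v⁻¹ + c + 1) * (J + S * A) := by ring

/-- Chaining. -/
lemma chain_n {d : ℕ} {Q : Set (Ed d)} (hQ : Convex ℝ Q) {J : Ed d → ℝ≥0∞} {D : ℝ≥0∞} {s : ℝ}
    (H : ∀ z ∈ Q, ∀ z' ∈ Q, dist z z' < s / 2 → J z' ≤ D * J z) (n : ℕ) :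
    ∀ z ∈ Q, ∀ z' ∈ Q, dist z z' < ((n : ℝ) + 1) * (s / 2) → J z' ≤ D ^ (n + 1) * J z := by
  induction n with
  | zero => intro z hz z' hz' h; simpa using H z hz z' hz' (by simpa using h)
  | succ n ih =>
    intro z hz z' hz' h
    push_cast at h
    set t : ℝ := ((n : ℝ) + 1) / ((n : ℝ) + 1 + 1)
    have hn : (0:ℝ) < (n : ℝ) + 1 + 1 := by positivity
    have ht0 : 0 ≤ t := by positivity
    have ht1 : t ≤ 1 := by rw [div_le_one hn]; linarith
    have hw : AffineMap.lineMap z z' t ∈ Q := hQ.lineMap_mem hz hz' ⟨ht0, ht1⟩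
    have e1 : dist z (AffineMap.lineMap z z' t) < ((n : ℝ) + 1) * (s / 2) := by
      rw [dist_left_lineMap, Real.norm_of_nonneg ht0, div_mul_eq_mul_div, div_lt_iff₀ hn]
      nlinarith [(by positivity : (0:ℝ) < (n : ℝ) + 1)]
    have e2 : dist (AffineMap.lineMap z z' t) z' < s / 2 := by
      rw [dist_lineMap_right, Real.norm_of_nonneg (by linarith)]
      have : 1 - t = 1 / ((n : ℝ) + 1 + 1) := by
        simp only [t]; field_simp; ring
      rw [this, div_mul_eq_mul_div, div_lt_iff₀ hn]
      linarith
    calc J z' ≤ D * J (AffineMap.lineMap z z' t) := H _ hw _ hz' e2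
      _ ≤ D * (D ^ (n + 1) * J z) := mul_le_mul_right (ih z hz _ hw e1) _
      _ = D ^ (n + 1 + 1) * J z := by ring

lemma mem_cube {d : ℕ} {δ : ℝ} {x : Ed d} : x ∈ cube d δ ↔ ∀ i, |x i| < δ := by
  simp [cube, cubeAt]

lemma cube_isOpen {d : ℕ} (δ : ℝ) : IsOpen (cube d δ) := by
  have : cube d δ = ⋂ i, {x : Ed d | |x i| < δ} := by ext x; simp [mem_cube]
  rw [this]
  exact isOpen_iInter_of_finite (fun i => isOpen_lt (by fun_prop) continuous_const)

lemma cube_convex {d : ℕ} (δ : ℝ) : Convex ℝ (cube d δ) := by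
  intro x hx y hy a b ha hb hab
  rw [mem_cube] at *
  intro i
  have h1 := abs_lt.1 (hx i)
  have h2 := abs_lt.1 (hy i)
  simp only [PiLp.add_apply, PiLp.smul_apply, smul_eq_mul]
  have := (convex_Ioo (-δ) δ) h1 h2 ha hb hab
  exact abs_lt.2 this

lemma cube_bounded {d : ℕ} (δ : ℝ) : Bornology.IsBounded (cube d δ) := by
  rw [isBounded_iff_subset_closedBall 0]
  refine ⟨Real.sqrt (d * δ ^ 2), fun x hx => ?_⟩
  rw [mem_cube] at hx
  rw [mem_closedBall_zero_iff, EuclideanSpace.norm_eq]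
  apply Real.sqrt_le_sqrt
  calc ∑ i, ‖x i‖ ^ 2 ≤ ∑ _i : Fin d, δ ^ 2 :=
        Finset.sum_le_sum fun i _ => by
          have := (hx i).le
          rw [Real.norm_eq_abs]
          gcongr
    _ = d * δ ^ 2 := by simp

lemma smul_mem_cube {d : ℕ} {l δ : ℝ} (hl : 0 < l) {y : Ed d} :
    l • y ∈ cube d (l * δ) ↔ y ∈ cube d δ := by
  simp only [mem_cube, PiLp.smul_apply, smul_eq_mul, abs_mul, abs_of_pos hl]
  exact forall_congr' fun i => mul_lt_mul_iff_right₀ hl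


/-! ### Conclusion -/

lemma lint_cover {d : ℕ} (T : Finset (Ed d)) (S : Ed d → Set (Ed d)) (h : Ed d → ℝ≥0∞) :
    ∫⁻ x in ⋃ t ∈ T, S t, h x ≤ ∑ t ∈ T, ∫⁻ x in S t, h x := by
  classical
  induction T using Finset.induction_on with
  | empty => simp
  | insert a T ha ih =>
    rw [Finset.set_biUnion_insert, Finset.sum_insert ha]
    exact (lintegral_union_le _ _ _).trans (add_le_add le_rfl ih)

lemma cube_est {d : ℕ} (hd : 1 ≤ d) {lam Lam C0 : ℝ} (hlam : 0 < lam) (hLam : lam ≤ Lam)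
    (hC0 : 0 ≤ C0) {K : Ed d → ℝ} (hK : KernCond K) :
    ∃ ε C : ℝ, 0 < ε ∧ 0 < C ∧
      ∀ r, 0 < r → r ≤ 1 → ∀ l, 0 < l → l ≤ 9 * Real.sqrt d →
      ∀ f : Ed d → ℝ, ContinuousOn f (cube d l) → ∀ u : Ed d → ℝ,
      LowerSemicontinuous u → (∀ y, 0 ≤ u y) → SupersolExtremal lam Lam C0 r K f (cube d l) u →
      ∀ F, 0 < F →
      ENNReal.ofReal l ^ d * (∫⁻ x in cube d l, ENNReal.ofReal |f x| ^ d) ≤ ENNReal.ofReal F ^ d →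
      ∀ x0 ∈ cube d (l / (9 * Real.sqrt d)),
        ∫⁻ x in cube d (l / (9 * Real.sqrt d)), ENNReal.ofReal (u x ^ ε) ≤
          ENNReal.ofReal (C * l ^ d * (u x0 + F) ^ ε) := by
  obtain ⟨ε, C, s0, hε, hε1, hC, hs0, hs01, hloc⟩ := local_est hd hlam hLam hC0 hK
  have hsq : 1 ≤ Real.sqrt d := by
    rw [Real.one_le_sqrt]; exact_mod_cast hd
  have h9 : 0 < 9 * Real.sqrt d := by linarith
  set δ : ℝ := 1 / (9 * Real.sqrt d) with hδ
  have hδ0 : 0 < δ := by positivity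
  have hδ9 : δ ≤ 1 / 9 := by
    rw [hδ]; apply one_div_le_one_div_of_le <;> linarith
  set σ : ℝ := s0 * δ with hσ
  have hσ0 : 0 < σ := by positivity
  have hσδ : σ ≤ δ := by rw [hσ]; nlinarith
  obtain ⟨T, hTQ, hTf, hTc⟩ := finite_approx_of_totallyBounded
    ((cube_bounded (d := d) δ).isCompact_closure.totallyBounded.subset subset_closure) σ hσ0
  obtain ⟨R, hR⟩ := isBounded_iff.1 (cube_bounded (d := d) δ)
  obtain ⟨n, hn⟩ := exists_nat_gt (R / (σ / 2))
  set v := ENNReal.ofReal (1 / 2) ^ d * volume (ball (0 : Ed d) 1) with hv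
  have hv0 : v ≠ 0 := by
    rw [hv]
    refine mul_ne_zero (pow_ne_zero _ (by simp)) (measure_ball_pos _ _ one_pos).ne'
  set D : ℝ≥0∞ := ENNReal.ofReal C * v⁻¹ + ENNReal.ofReal C + 1 with hD
  have hDt : D ≠ ⊤ := by
    have : v⁻¹ ≠ ⊤ := ENNReal.inv_ne_top.2 hv0
    rw [hD]
    exact ENNReal.add_ne_top.2 ⟨ENNReal.add_ne_top.2 ⟨ENNReal.mul_ne_top ENNReal.ofReal_ne_top this,
      ENNReal.ofReal_ne_top⟩, ENNReal.one_ne_top⟩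
  set B : ℝ≥0∞ := (hTf.toFinset.card : ℝ≥0∞) * D ^ (n + 1) with hB
  have hBt : B ≠ ⊤ := by
    rw [hB]; exact ENNReal.mul_ne_top (ENNReal.natCast_ne_top _) (ENNReal.pow_ne_top hDt)
  refine ⟨ε, B.toReal * (C + 1) + 1, hε, by positivity, ?_⟩
  intro r hr hr1 l hl hl9 f hf u hu hu0 hsup F hF hfF x0 hx0
  have hlδ : l / (9 * Real.sqrt d) = l * δ := by rw [hδ]; ring
  rw [hlδ] at hx0 ⊢
  set s : ℝ := l * σ with hs
  have hspos : 0 < s := by positivity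
  have hss0 : s ≤ s0 := by
    have : l * δ ≤ 1 := by rw [hδ, mul_one_div, div_le_one h9]; exact hl9
    calc s = s0 * (l * δ) := by rw [hs, hσ]; ring
      _ ≤ s0 * 1 := by gcongr
      _ = s0 := mul_one _
  have hsl : s ≤ l := by rw [hs]; nlinarith
  have hum : Measurable u := hu.measurable
  have Hz : ∀ z ∈ cube d (l * δ), ∀ y ∈ ball z s, ∫⁻ x in ball z s, ENNReal.ofReal (u x ^ ε) ≤
        ENNReal.ofReal s ^ d * ENNReal.ofReal (C * (u y + F) ^ ε) := by
    intro z hz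
    refine hloc r hr hr1 s hspos hss0 z (cube d l) (cube_isOpen l).measurableSet ?_ f hf u hu hu0
      hsup F hF ?_
    · intro y hy
      rw [mem_cube] at hz ⊢
      intro i
      have h1 : |y i - z i| ≤ dist y z := by
        have := PiLp.norm_apply_le (y - z) i
        rw [dist_eq_norm]
        simpa using this
      rw [mem_ball] at hy
      have h2 : |y i| ≤ |y i - z i| + |z i| := by
        have := abs_add_le (y i - z i) (z i); simpa using this
      have h3 := hz i
      have h4 : s * 3 ≤ l * (1 / 3) := by
        rw [hs, mul_assoc]; gcongr; linarith
      have h5 : l * δ ≤ l * (1 / 9) := by gcongr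
      linarith
    · refine le_trans (mul_le_mul_left ?_ _) hfF
      exact pow_le_pow_left' (ENNReal.ofReal_le_ofReal hsl) d
  set X := ENNReal.ofReal s ^ d * ENNReal.ofReal (F ^ ε) with hX
  have hch := chain_n (cube_convex (d := d) (l * δ))
    (J := fun z => (∫⁻ x in ball z s, ENNReal.ofReal (u x ^ ε)) + X) (D := D) (s := s)
    (fun z hz z' hz' hzz => chain_step hε hε1 hC hspos hF hum hu0 (Hz z' hz') hzz) n x0 hx0
  obtain ⟨x1, rfl⟩ : ∃ x1, x0 = l • x1 := ⟨l⁻¹ • x0, by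
    rw [smul_smul, mul_inv_cancel₀ hl.ne', one_smul]⟩
  have hx1 := (smul_mem_cube hl).1 hx0
  have hch' : ∀ t ∈ T, ∫⁻ x in ball (l • t) s, ENNReal.ofReal (u x ^ ε) ≤
      D ^ (n + 1) * ((∫⁻ x in ball (l • x1) s, ENNReal.ofReal (u x ^ ε)) + X) := by
    intro t ht
    refine le_trans le_self_add (hch (l • t) ((smul_mem_cube hl).2 (hTQ ht)) ?_)
    rw [dist_smul₀, Real.norm_of_nonneg hl.le]
    have h1 := hR hx1 (hTQ ht)
    rw [div_lt_iff₀ (by positivity)] at hn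
    have h2 : dist x1 t < ((n : ℝ) + 1) * (σ / 2) := by nlinarith
    calc l * dist x1 t < l * (((n : ℝ) + 1) * (σ / 2)) := by gcongr
      _ = _ := by rw [hs]; ring
  have hcov : cube d (l * δ) ⊆ ⋃ t ∈ hTf.toFinset, ball (l • t) s := by
    intro y hy
    obtain ⟨y1, rfl⟩ : ∃ y1, y = l • y1 := ⟨l⁻¹ • y, by
      rw [smul_smul, mul_inv_cancel₀ hl.ne', one_smul]⟩
    have hy1 := hTc ((smul_mem_cube hl).1 hy)
    simp only [mem_iUnion, exists_prop] at hy1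
    obtain ⟨t, ht, hyt⟩ := hy1
    simp only [mem_iUnion, exists_prop]
    refine ⟨t, hTf.mem_toFinset.2 ht, ?_⟩
    rw [mem_ball] at hyt ⊢
    rw [dist_smul₀, Real.norm_of_nonneg hl.le, hs]
    gcongr
  have hsum : ∫⁻ x in cube d (l * δ), ENNReal.ofReal (u x ^ ε) ≤
      B * ((∫⁻ x in ball (l • x1) s, ENNReal.ofReal (u x ^ ε)) + X) := by
    calc _ ≤ ∫⁻ x in ⋃ t ∈ hTf.toFinset, ball (l • t) s, ENNReal.ofReal (u x ^ ε) :=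
          lintegral_mono_set hcov
      _ ≤ ∑ t ∈ hTf.toFinset, ∫⁻ x in ball (l • t) s, ENNReal.ofReal (u x ^ ε) :=
          lint_cover _ _ _
      _ ≤ ∑ t ∈ hTf.toFinset,
            D ^ (n + 1) * ((∫⁻ x in ball (l • x1) s, ENNReal.ofReal (u x ^ ε)) + X) :=
          Finset.sum_le_sum fun t ht => hch' t (hTf.mem_toFinset.1 ht)
      _ = _ := by rw [Finset.sum_const, nsmul_eq_mul, hB, mul_assoc]
  refine hsum.trans ?_
  set a : ℝ := (u (l • x1) + F) ^ ε with ha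
  have ha0 : 0 ≤ a := Real.rpow_nonneg (by linarith [hu0 (l • x1)]) _
  have hFa : F ^ ε ≤ a := Real.rpow_le_rpow hF.le (by linarith [hu0 (l • x1)]) hε.le
  have hin : (∫⁻ x in ball (l • x1) s, ENNReal.ofReal (u x ^ ε)) + X ≤
      ENNReal.ofReal (l ^ d * ((C + 1) * a)) := by
    have h1 := Hz _ hx0 (l • x1) (mem_ball_self hspos)
    have h2 : X ≤ ENNReal.ofReal s ^ d * ENNReal.ofReal a :=
      mul_le_mul_right (ENNReal.ofReal_le_ofReal hFa) _
    refine (add_le_add h1 h2).trans ?_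
    rw [← mul_add, ← ENNReal.ofReal_add (by positivity) ha0,
      ENNReal.ofReal_mul (p := l ^ d) (by positivity), ENNReal.ofReal_pow hl.le]
    refine mul_le_mul' (pow_le_pow_left' (ENNReal.ofReal_le_ofReal hsl) d) (le_of_eq ?_)
    congr 1; ring
  refine (mul_le_mul_right hin B).trans ?_
  rw [← ENNReal.ofReal_toReal hBt, ← ENNReal.ofReal_mul ENNReal.toReal_nonneg]
  rw [ENNReal.toReal_ofReal ENNReal.toReal_nonneg]
  apply ENNReal.ofReal_le_ofReal
  have : 0 ≤ l ^ d * a := by positivity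
  nlinarith

lemma lint_eq_Lnorm {d : ℕ} (hd : 1 ≤ d) {S : Set (Ed d)} (f : Ed d → ℝ)
    (hf : IntegrableOn (fun x => |f x| ^ (d : ℝ)) S) :
    ∫⁻ x in S, ENNReal.ofReal |f x| ^ d = ENNReal.ofReal (LnormOn (d : ℝ) S f) ^ d := by
  have hd0 : (d : ℝ) ≠ 0 := by exact_mod_cast (by omega : d ≠ 0)
  have hnn : 0 ≤ ∫ x in S, |f x| ^ (d : ℝ) := integral_nonneg fun x => by positivity
  have h1 : LnormOn (d : ℝ) S f ^ d = ∫ x in S, |f x| ^ (d : ℝ) := by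
    rw [LnormOn, ← Real.rpow_natCast, ← Real.rpow_mul hnn, one_div, inv_mul_cancel₀ hd0,
      Real.rpow_one]
  rw [← ENNReal.ofReal_pow (by unfold LnormOn; positivity), h1,
    ofReal_integral_eq_lintegral_ofReal hf (ae_of_all _ fun x => by positivity)]
  refine lintegral_congr fun x => ?_
  rw [Real.rpow_natCast, ENNReal.ofReal_pow (abs_nonneg _)]

end HarnackProof

/-- the scaled weak Harnack inequality (Corollary 3.10). -/
theorem weak_harnack_scaled {d : ℕ} (hd : 1 ≤ d) (lam Lam C0 : ℝ)
    (hlam : 0 < lam) (hLam : lam ≤ Lam) (hC0 : 0 ≤ C0)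
    (K : Ed d → ℝ) (hK : KernCond K) :
    ∃ ε₃ C : ℝ, 0 < ε₃ ∧ 0 < C ∧
      ∀ r : ℝ, 0 < r → r ≤ 1 → ∀ l : ℝ, 0 < l → l ≤ 9 * Real.sqrt d →
      ∀ f : Ed d → ℝ, ContinuousOn f (cube d l) →
        IntegrableOn (fun x => |f x| ^ (d : ℝ)) (cube d l) →
      ∀ u : Ed d → ℝ, LowerSemicontinuous u → IsBddFun u → (∀ x, 0 ≤ u x) →
        SupersolExtremal lam Lam C0 r K f (cube d l) u →
        (∫ x in cube d (l / (9 * Real.sqrt d)), u x ^ ε₃) ≤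
          C * l ^ (d : ℝ) *
            (sInf (u '' cube d (l / (9 * Real.sqrt d))) + l * LnormOn (d : ℝ) (cube d l) f)
              ^ ε₃ := by
  obtain ⟨ε, C, hε, hC, hest⟩ := cube_est hd hlam hLam hC0 hK
  refine ⟨ε, C, hε, hC, ?_⟩
  intro r hr hr1 l hl hl9 f hf hfi u hu hub hu0 hsup
  obtain ⟨M, hM⟩ := hub
  have hsq : 0 < Real.sqrt d := Real.sqrt_pos.2 (by exact_mod_cast hd)
  set Q : Set (Ed d) := cube d (l / (9 * Real.sqrt d)) with hQ
  set L := LnormOn (d : ℝ) (cube d l) f with hL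
  have hL0 : 0 ≤ L := by
    rw [hL]; unfold LnormOn
    exact Real.rpow_nonneg (integral_nonneg fun x => Real.rpow_nonneg (abs_nonneg _) _) _
  have hQm : MeasurableSet Q := (cube_isOpen _).measurableSet
  have hQfin : volume Q ≠ ⊤ := (cube_bounded _).measure_lt_top.ne
  have hQne : Q.Nonempty := ⟨0, by
    rw [hQ, mem_cube]; intro i; simp only [PiLp.zero_apply, abs_zero]; positivity⟩
  have hmeas : Measurable (fun x => u x ^ ε) := hu.measurable.pow_const ε
  have hint : IntegrableOn (fun x => u x ^ ε) Q := by
    refine IntegrableOn.of_bound hQfin.lt_top hmeas.aestronglyMeasurable (M ^ ε)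
      (ae_of_all _ fun x => ?_)
    rw [Real.norm_of_nonneg (Real.rpow_nonneg (hu0 x) _)]
    exact Real.rpow_le_rpow (hu0 x) ((le_abs_self _).trans (hM x)) hε.le
  have hpt : ∀ x ∈ Q, ∀ τ : ℝ, 0 < τ →
      (∫ y in Q, u y ^ ε) ≤ C * l ^ d * (u x + (l * L + τ)) ^ ε := by
    intro x hx τ hτ
    have h := hest r hr hr1 l hl hl9 f hf u hu hu0 hsup (l * L + τ) (by positivity) (by
      rw [lint_eq_Lnorm hd f hfi, ← mul_pow, ← ENNReal.ofReal_mul hl.le]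
      exact pow_le_pow_left' (ENNReal.ofReal_le_ofReal (by linarith)) d) x hx
    rw [← ofReal_integral_eq_lintegral_ofReal hint
      (ae_of_all _ fun x => Real.rpow_nonneg (hu0 x) _)] at h
    refine (ENNReal.ofReal_le_ofReal_iff ?_).1 h
    have : 0 ≤ (u x + (l * L + τ)) ^ ε := Real.rpow_nonneg (by have := hu0 x; positivity) _
    positivity
  have hI0 : 0 ≤ sInf (u '' Q) := Real.sInf_nonneg (by rintro _ ⟨x, _, rfl⟩; exact hu0 x)
  have hτ : ∀ τ : ℝ, 0 < τ →
      (∫ y in Q, u y ^ ε) ≤ C * l ^ d * (sInf (u '' Q) + l * L + τ) ^ ε := by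
    intro τ hτ
    obtain ⟨_, ⟨x, hx, rfl⟩, hlt⟩ := exists_lt_of_csInf_lt (hQne.image u)
      (by linarith : sInf (u '' Q) < sInf (u '' Q) + τ / 2)
    refine (hpt x hx (τ / 2) (by positivity)).trans ?_
    refine mul_le_mul_of_nonneg_left (Real.rpow_le_rpow ?_ (by linarith) hε.le) (by positivity)
    have := hu0 x
    positivity
  rw [Real.rpow_natCast]
  have hcont : Filter.Tendsto (fun τ : ℝ => C * l ^ d * (sInf (u '' Q) + l * L + τ) ^ ε)
      (nhdsWithin 0 (Ioi 0)) (nhds (C * l ^ d * (sInf (u '' Q) + l * L + 0) ^ ε)) := by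
    refine Filter.Tendsto.mono_left ?_ nhdsWithin_le_nhds
    have : Continuous (fun τ : ℝ => C * l ^ d * (sInf (u '' Q) + l * L + τ) ^ ε) :=
      continuous_const.mul ((continuous_const.add continuous_id).rpow_const
        (fun _ => Or.inr hε.le))
    exact this.tendsto 0
  rw [add_zero] at hcont
  refine ge_of_tendsto hcont ?_
  filter_upwards [self_mem_nhdsWithin] with τ ht using hτ τ ht
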